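/- arXiv:2309.02116 — 2 statements merged into one kernel-verified Lean document; each statement's English description precedes it below -/
import Mathlib

section
/- Let ℋ = ⊕_{i∈ℤ} ℋ_i be a graded ℂ[∂]-module. Then C•_cs(ℋ) = ⊕_{n∈ℤ} C^n_cs(ℋ) equipped with the bracket ⟦φ,ψ⟧ = Σ_{p≥1} Σ_{k+l=p+1} (φ_k ⋄ ψ_l − (−1)^{mn} ψ_l ⋄ φ_k), for φ = Σ_k φ_k ∈ C^n_cs(ℋ) and ψ = Σ_l ψ_l ∈ C^m_cs(ℋ), is a graded Lie algebra: ⟦·,·⟧ is graded skew-symmetric and satisfies the graded Jacobi identity. -/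
noncomputable section
open scoped BigOperators Classical

namespace LCG

variable {V : Type} [AddCommGroup V] [Module ℂ V]

/-- An "arity map": a `k`-ary conformal map `𝒢^{⊗k} → 𝒢[[λ₁,…,λ_{k−1}]]`, encoded as a
function taking a degree function `d` for the arguments (used by operations obtained
by brackets, which involve Koszul signs), a sequence of arguments (only the first `k`
entries are relevant) and an exponent vector for the monomial `λ₁^{a_1}⋯λ_{k−1}^{a_{k-1}}`
(only the first `k−1` entries relevant), and returning the corresponding coefficient. -/
abbrev AMap (V : Type) := (ℕ → ℤ) → (ℕ → V) → (ℕ → ℕ) → V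

/-- Extension of a permutation of `Fin q` to `ℕ`, fixing everything `≥ q`. -/
def shExt {q : ℕ} (σ : Equiv.Perm (Fin q)) : ℕ → ℕ :=
  fun t => if h : t < q then ((σ ⟨t, h⟩ : Fin q) : ℕ) else t

/-- `σ` is an `(a, m)`-unshuffle: increasing on the first `a` indices and on the last
`m` indices. -/
def IsShuffle (a m : ℕ) (σ : Equiv.Perm (Fin (a + m))) : Prop :=
  (∀ s t : Fin (a + m), s < t → (t : ℕ) < a → σ s < σ t) ∧
  (∀ s t : Fin (a + m), s < t → a ≤ (s : ℕ) → σ s < σ t)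

/-- The Koszul sign `ε(σ)` of a permutation `σ` with respect to the degrees `d` of the
permuted homogeneous elements. -/
def koszul (d : ℕ → ℤ) {q : ℕ} (σ : Equiv.Perm (Fin q)) : ℤ :=
  ∏ p ∈ Finset.univ.filter (fun p : Fin q × Fin q => p.1 < p.2 ∧ σ p.2 < σ p.1),
    ((Int.negOnePow (d ((σ p.1 : Fin q) : ℕ) * d ((σ p.2 : Fin q) : ℕ))) : ℤ)

/-- The (unsigned) substitution term appearing in all the shuffle compositions:
`φ(h_{σ(1)},…,h_{σ(i−1)}, ψ(h_{σ(i)},…,h_{σ(i+l−2)}, h_{i+l−1}), h_{i+l},…,h_p)`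
with the variables of `φ` being
`λ_{σ(1)},…,λ_{σ(i−1)}, λ_{σ(i)}+⋯+λ_{σ(i+l−2)}+λ_{i+l−1}, λ_{i+l},…,λ_{p−1}`,
written coefficientwise (the substitution of the sum of variables being expanded via
multinomial coefficients).  Here `ii = i − 1` is `0`-indexed, `m` is the degree of the
inner map `ψ` (used only for the degree bookkeeping of the inserted element). -/
def dTerm (m : ℤ) (k l ii : ℕ) (σ : Equiv.Perm (Fin (ii + (l - 1))))
    (φ ψ : AMap V) (d : ℕ → ℤ) (h : ℕ → V) (a : ℕ → ℕ) : V :=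
  let σ' := shExt σ
  let q := ii + (l - 1)
  let dIn : ℕ → ℤ := fun t => if t < l - 1 then d (σ' (ii + t)) else d q
  let hIn : ℕ → V := fun t => if t < l - 1 then h (σ' (ii + t)) else h q
  let mIn : ℤ := (∑ t ∈ Finset.range (l - 1), d (σ' (ii + t))) + d q + m
  if ii + 1 < k then
    ∑ b ∈ Fintype.piFinset (fun t : Fin (l - 1) => Finset.range (a (σ' (ii + (t : ℕ))) + 1)),
      (Nat.multinomial Finset.univ
          (fun t : Fin l => if ht : (t : ℕ) < l - 1 then a (σ' (ii + (t : ℕ))) - b ⟨t, ht⟩ else a q) : ℤ) •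
        φ (fun s => if s < ii then d (σ' s) else if s = ii then mIn else d (s + (l - 1)))
          (fun s => if s < ii then h (σ' s) else if s = ii then
              ψ dIn hIn (fun t => if ht : t < l - 1 then b ⟨t, ht⟩ else 0)
            else h (s + (l - 1)))
          (fun s => if s < ii then a (σ' s) else if s = ii then
              ∑ t : Fin l, (if ht : (t : ℕ) < l - 1 then a (σ' (ii + (t : ℕ))) - b ⟨t, ht⟩ else a q)
            else a (s + (l - 1)))
  else
    φ (fun s => if s < ii then d (σ' s) else mIn)
      (fun s => if s < ii then h (σ' s) else ψ dIn hIn (fun t => a (σ' (ii + t))))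
      (fun s => a (σ' s))

/-- The shuffle composition `φ_k ⋄ ψ_l` (for `ψ` of degree `m`), with sign
`ε(σ)·(−1)^{m(|h_{σ(1)}|+⋯+|h_{σ(i−1)}|)}`. -/
def dia (m : ℤ) (k l : ℕ) (φ ψ : AMap V) : AMap V := fun d h a =>
  ∑ ii ∈ Finset.range k,
    ∑ σ ∈ Finset.univ.filter (fun σ : Equiv.Perm (Fin (ii + (l - 1))) => IsShuffle ii (l - 1) σ),
      (koszul d σ *
        ((Int.negOnePow (m * ∑ s ∈ Finset.range ii, d (shExt σ s))) : ℤ)) •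
        dTerm m k l ii σ φ ψ d h a

/-- The composition appearing in the `Leib_∞`-identities, with sign
`ε(σ)·sgn(σ)·(−1)^{(k−i−1)(l−1)}·(−1)^{l(|x_{σ(1)}|+⋯+|x_{σ(i−1)}|)}` (the inner map
`ρ_l` has degree `l − 2`). -/
def diaL (k l : ℕ) (φ ψ : AMap V) : AMap V := fun d h a =>
  ∑ ii ∈ Finset.range k,
    ∑ σ ∈ Finset.univ.filter (fun σ : Equiv.Perm (Fin (ii + (l - 1))) => IsShuffle ii (l - 1) σ),
      (koszul d σ * ((Equiv.Perm.sign σ : ℤ))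
        * ((Int.negOnePow (((k : ℤ) - ii - 2) * ((l : ℤ) - 1))) : ℤ)
        * ((Int.negOnePow ((l : ℤ) * ∑ s ∈ Finset.range ii, d (shExt σ s))) : ℤ)) •
        dTerm ((l : ℤ) - 2) k l ii σ φ ψ d h a

/-- `φ` only depends on its first `k` arguments and first `k-1` exponents (and not on
the degree function). -/
def IsArity (k : ℕ) (φ : AMap V) : Prop :=
  ∀ d d' h h' a a', (∀ j, j < k → h j = h' j) → (∀ j, j < k - 1 → a j = a' j) →
    φ d h a = φ d' h' a'

/-- `φ` is ℂ-multilinear in its first `k` arguments. -/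
def IsMultilin (k : ℕ) (φ : AMap V) : Prop :=
  ∀ d h a j, j < k →
    (∀ u v : V, φ d (Function.update h j (u + v)) a
      = φ d (Function.update h j u) a + φ d (Function.update h j v) a) ∧
    (∀ (c : ℂ) (u : V), φ d (Function.update h j (c • u)) a
      = c • φ d (Function.update h j u) a)

/-- Conformal sesquilinearity of a `k`-ary map:
`φ(…,∂x_j,…) = −λ_j·φ(…)` for `j < k−1` and `φ(…,∂x_k) = (∂+λ₁+⋯+λ_{k−1})·φ(…)`. -/
def IsSesq (D : V →ₗ[ℂ] V) (k : ℕ) (φ : AMap V) : Prop :=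
  (∀ d h a j, j < k - 1 → φ d (Function.update h j (D (h j))) a
      = - (if a j = 0 then 0 else φ d h (Function.update a j (a j - 1)))) ∧
  (∀ d h a, φ d (Function.update h (k - 1) (D (h (k - 1)))) a
      = D (φ d h a)
        + ∑ j ∈ Finset.range (k - 1), (if a j = 0 then 0 else φ d h (Function.update a j (a j - 1))))

/-- `φ` is homogeneous of degree `r` with respect to the grading `G`. -/
def HasDeg (G : ℤ → Submodule ℂ V) (k : ℕ) (r : ℤ) (φ : AMap V) : Prop :=
  ∀ (d : ℕ → ℤ) (h : ℕ → V) (a : ℕ → ℕ), (∀ j, j < k → h j ∈ G (d j)) →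
    φ d h a ∈ G ((∑ j ∈ Finset.range k, d j) + r)

/-- The grading of the shift `𝒢[−1]`: `(𝒢[−1])_i = 𝒢_{i−1}`. -/
def shiftG (G : ℤ → Submodule ℂ V) : ℤ → Submodule ℂ V := fun i => G (i - 1)

/-- The higher identities (iden-lca) of a `Leib_∞`-conformal algebra, evaluated on
homogeneous elements. -/
def LeibIdent (G : ℤ → Submodule ℂ V) (ρ : ℕ → AMap V) : Prop :=
  ∀ n, 1 ≤ n → ∀ (d : ℕ → ℤ) (h : ℕ → V), (∀ t, h t ∈ G (d t)) → ∀ a,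
    ∑ k ∈ Finset.Icc 1 n, diaL k (n + 1 - k) (ρ k) (ρ (n + 1 - k)) d h a = 0

/-- The higher identities (iden-lca1) of a `Leib_∞[1]`-conformal algebra, evaluated on
homogeneous elements: `∑_{k+l=n+1} ϱ_k ⋄ ϱ_l = 0`. -/
def LeibOneIdent (G : ℤ → Submodule ℂ V) (ϱ : ℕ → AMap V) : Prop :=
  ∀ n, 1 ≤ n → ∀ (d : ℕ → ℤ) (h : ℕ → V), (∀ t, h t ∈ G (d t)) → ∀ a,
    ∑ k ∈ Finset.Icc 1 n, dia (-1) k (n + 1 - k) (ϱ k) (ϱ (n + 1 - k)) d h a = 0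

/-- A `Leib_∞`-conformal algebra structure `{ρ_k}_{k≥1}` on the graded module `(V, G)`:
each `ρ_k` is a conformal sesquilinear ℂ-multilinear map of degree `k − 2`, and the
identities (iden-lca) hold. -/
def IsLeibInfty (G : ℤ → Submodule ℂ V) (D : V →ₗ[ℂ] V) (ρ : ℕ → AMap V) : Prop :=
  (∀ k, 1 ≤ k → IsArity k (ρ k) ∧ IsMultilin k (ρ k) ∧ IsSesq D k (ρ k)
      ∧ HasDeg G k ((k : ℤ) - 2) (ρ k)) ∧
  LeibIdent G ρ

/-- A `Leib_∞[1]`-conformal algebra structure `{ϱ_k}_{k≥1}` on the graded module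
`(V, G)`: each `ϱ_k` is conformal sesquilinear ℂ-multilinear of degree `−1`, and the
identities (iden-lca1) hold. -/
def IsLeibOne (G : ℤ → Submodule ℂ V) (D : V →ₗ[ℂ] V) (ϱ : ℕ → AMap V) : Prop :=
  (∀ k, 1 ≤ k → IsArity k (ϱ k) ∧ IsMultilin k (ϱ k) ∧ IsSesq D k (ϱ k)
      ∧ HasDeg G k (-1) (ϱ k)) ∧
  LeibOneIdent G ϱ

/-- The graded Lie bracket `⟦φ,ψ⟧` on `C•_cs`, for `φ` of degree `n` and `ψ` of degree
`m`, arity-`p` component. -/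
def Br (n m : ℤ) (φ ψ : ℕ → AMap V) : ℕ → AMap V := fun p => fun d h a =>
  ∑ k ∈ Finset.Icc 1 p,
    (dia m k (p + 1 - k) (φ k) (ψ (p + 1 - k)) d h a
      - ((Int.negOnePow (m * n)) : ℤ) • dia n (p + 1 - k) k (ψ (p + 1 - k)) (φ k) d h a)

end LCG

namespace LCG

variable {V : Type} [AddCommGroup V]

/-- A labelled version of `AMap`: arguments are indexed by a finite set `X` of labels, and the
monomial `∏ λ_x ^ a_x` is replaced by a finite set `A` of tokens placed on the labels by `f`. -/
abbrev LMap (V : Type) :=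
  Finset ℕ → (ℕ → ℤ) → (ℕ → V) → Finset (ℕ × ℕ) → (ℕ × ℕ → ℕ) → V

/-- The largest label of `T`. -/
def top (T : Finset ℕ) : ℕ := T.sup id

/-- The labels left after contracting `T` to its largest element. -/
def contract (X T : Finset ℕ) : Finset ℕ := insert (top T) (X \ T)

/-- The placement of tokens after contracting `T` to its largest element. -/
def pushTokens (T : Finset ℕ) (f : ℕ × ℕ → ℕ) : ℕ × ℕ → ℕ :=
  fun y => if f y ∈ T then top T else f y

/-- The exponent of the sign with which a map of degree `m` is inserted at the labels `T`. -/
def signExp (m : ℤ) (X T : Finset ℕ) (d : ℕ → ℤ) : ℤ :=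
  ∑ x ∈ (X \ T).filter (· < top T), d x * (m + ∑ t ∈ T.filter (· < x), d t)

/-- The choices of labels `T` and tokens `B` that are fed to the inner map. -/
def feeds (X : Finset ℕ) (A : Finset (ℕ × ℕ)) (f : ℕ × ℕ → ℕ) :
    Finset (Finset ℕ × Finset (ℕ × ℕ)) :=
  (X.powerset ×ˢ A.powerset).filter (fun P => P.1.Nonempty ∧ ∀ y ∈ P.2, f y ∈ P.1)

/-- The unsigned insertion of `Ψ`, of degree `m`, at the labels `T` and tokens `B`. -/
def insertAt (m : ℤ) (Φ Ψ : LMap V) (T : Finset ℕ) (B : Finset (ℕ × ℕ)) : LMap V :=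
  fun X d h A f =>
    Φ (contract X T) (Function.update d (top T) (∑ t ∈ T, d t + m))
      (Function.update h (top T) (Ψ T d h B f)) (A \ B) (pushTokens T f)

/-- The labelled shuffle composition. -/
def comp (m : ℤ) (Φ Ψ : LMap V) : LMap V := fun X d h A f =>
  ∑ P ∈ feeds X A f,
    ((Int.negOnePow (signExp m X P.1 d)) : ℤ) • insertAt m Φ Ψ P.1 P.2 X d h A f

/-- `Φ` depends only on the data visible on the labels `X` and the tokens `A`. -/
def IsLocal (Φ : LMap V) : Prop :=
  ∀ X d d' h h' A f f', (∀ x ∈ X, d x = d' x) → (∀ x ∈ X, h x = h' x) →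
    (∀ y ∈ A, f y = f' y) → Φ X d h A f = Φ X d' h' A f'

/-- `Φ` is additive in every argument. -/
def IsAdditive (Φ : LMap V) : Prop :=
  ∀ X d h A f, ∀ x ∈ X, ∀ u v : V, Φ X d (Function.update h x (u + v)) A f
    = Φ X d (Function.update h x u) A f + Φ X d (Function.update h x v) A f

lemma mem_feeds {X : Finset ℕ} {A : Finset (ℕ × ℕ)} {f : ℕ × ℕ → ℕ}
    {P : Finset ℕ × Finset (ℕ × ℕ)} :
    P ∈ feeds X A f ↔ P.1 ⊆ X ∧ P.2 ⊆ A ∧ P.1.Nonempty ∧ ∀ y ∈ P.2, f y ∈ P.1 := by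
  simp [feeds, and_assoc]

lemma top_mem {T : Finset ℕ} (hT : T.Nonempty) : top T ∈ T := by
  obtain ⟨x, hx, he⟩ := Finset.exists_mem_eq_sup T hT id
  unfold top
  rw [he]
  exact hx

lemma le_top {T : Finset ℕ} {x : ℕ} (hx : x ∈ T) : x ≤ top T :=
  Finset.le_sup (f := id) hx

lemma top_eq_of {T : Finset ℕ} {x : ℕ} (hx : x ∈ T) (h : ∀ y ∈ T, y ≤ x) : top T = x :=
  le_antisymm (Finset.sup_le h) (le_top hx)

/-- Evaluation of `Φ` in the argument labelled `x`, as an additive map. -/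
def argHom (Φ : LMap V) (hΦ : IsAdditive Φ) (X : Finset ℕ) (d : ℕ → ℤ) (h : ℕ → V)
    (A : Finset (ℕ × ℕ)) (f : ℕ × ℕ → ℕ) (x : ℕ) (hx : x ∈ X) : V →+ V :=
  AddMonoidHom.mk' (fun u => Φ X d (Function.update h x u) A f) (hΦ X d h A f x hx)

lemma argHom_apply (Φ : LMap V) (hΦ : IsAdditive Φ) (X : Finset ℕ) (d : ℕ → ℤ) (h : ℕ → V)
    (A : Finset (ℕ × ℕ)) (f : ℕ × ℕ → ℕ) (x : ℕ) (hx : x ∈ X) (u : V) :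
    argHom Φ hΦ X d h A f x hx u = Φ X d (Function.update h x u) A f := rfl

lemma comp_isAdditive (m : ℤ) {Φ Ψ : LMap V} (lΦ : IsLocal Φ) (hΦ : IsAdditive Φ)
    (lΨ : IsLocal Ψ) (hΨ : IsAdditive Ψ) : IsAdditive (comp m Φ Ψ) := by
  intro X d h A f x hx u v
  simp only [comp]
  rw [← Finset.sum_add_distrib]
  refine Finset.sum_congr rfl fun P hP => ?_
  obtain ⟨hT, hB, hne, hfB⟩ := mem_feeds.1 hP
  rw [← smul_add]
  congr 1
  unfold insertAt
  have hc : top P.1 ∈ contract X P.1 := by simp [contract]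
  by_cases hxT : x ∈ P.1
  · have key : ∀ w, Φ (contract X P.1) (Function.update d (top P.1) (∑ t ∈ P.1, d t + m))
        (Function.update (Function.update h x w) (top P.1)
          (Ψ P.1 d (Function.update h x w) P.2 f)) (A \ P.2) (pushTokens P.1 f)
        = Φ (contract X P.1) (Function.update d (top P.1) (∑ t ∈ P.1, d t + m))
        (Function.update h (top P.1)
          (Ψ P.1 d (Function.update h x w) P.2 f)) (A \ P.2) (pushTokens P.1 f) := by
      intro w
      refine lΦ _ _ _ _ _ _ _ _ (fun _ _ => rfl) (fun z hz => ?_) (fun _ _ => rfl)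
      by_cases hzt : z = top P.1
      · simp [hzt]
      · simp only [contract, Finset.mem_insert, hzt, Finset.mem_sdiff, false_or] at hz
        have : z ≠ x := fun e => hz.2 (e ▸ hxT)
        simp [hzt, this]
    rw [key, key, key, hΨ _ _ _ _ _ x hxT, hΦ _ _ _ _ _ _ hc]
  · have hxt : x ≠ top P.1 := fun e => hxT (e ▸ top_mem hne)
    have hin : ∀ w, Ψ P.1 d (Function.update h x w) P.2 f = Ψ P.1 d h P.2 f := by
      intro w
      refine lΨ _ _ _ _ _ _ _ _ (fun _ _ => rfl) (fun z hz => ?_) (fun _ _ => rfl)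
      have : z ≠ x := fun e => hxT (e ▸ hz)
      simp [this]
    have hxc : x ∈ contract X P.1 := by simp [contract, hx, hxT]
    simp only [hin]
    rw [Function.update_comm hxt, Function.update_comm hxt, Function.update_comm hxt,
      hΦ _ _ _ _ _ _ hxc]

lemma top_contract {U T : Finset ℕ} (hTU : T ⊆ U) (hT : T.Nonempty) :
    top (contract U T) = top U := by
  have hU := top_mem (hT.mono hTU)
  refine top_eq_of ?_ fun y hy => ?_
  · by_cases h : top U ∈ T
    · have : top U = top T := le_antisymm (le_top h) (le_top (hTU (top_mem hT)))
      simp [contract, this]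
    · simp [contract, h, hU]
  · rcases Finset.mem_insert.1 hy with rfl | hy
    · exact le_top (hTU (top_mem hT))
    · exact le_top (Finset.mem_sdiff.1 hy).1

lemma contract_contract {X U T : Finset ℕ} (hTU : T ⊆ U) (hT : T.Nonempty) :
    contract (contract X T) (contract U T) = contract X U := by
  ext x
  have htop := top_contract hTU hT
  have hmem := top_mem hT
  simp only [contract] at htop
  simp only [contract, htop, Finset.mem_insert, Finset.mem_sdiff]
  have := @hTU x
  have := hTU hmem
  by_cases hx : x = top T
  · subst hx; tauto
  · tauto

lemma pushTokens_pushTokens {U T : Finset ℕ} (hTU : T ⊆ U) (hT : T.Nonempty)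
    (f : ℕ × ℕ → ℕ) : pushTokens (contract U T) (pushTokens T f) = pushTokens U f := by
  funext y
  have hmem := top_mem hT
  have htop := top_contract hTU hT
  simp only [contract] at htop
  by_cases hy : f y ∈ T
  · simp [pushTokens, hy, hTU hy, htop, contract]
  · have hne : f y ≠ top T := fun e => hy (e ▸ hmem)
    by_cases hyU : f y ∈ U <;> simp [pushTokens, hy, hyU, htop, contract, hne]

lemma sum_contract {U T : Finset ℕ} (hTU : T ⊆ U) (hT : T.Nonempty) (d : ℕ → ℤ) (r : ℤ) :
    ∑ t ∈ contract U T, Function.update d (top T) (∑ t ∈ T, d t + r) t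
      = ∑ t ∈ U, d t + r := by
  have hmem := top_mem hT
  rw [contract, Finset.sum_insert (by simp [hmem]), ← Finset.sum_sdiff hTU]
  have : ∀ x ∈ U \ T, Function.update d (top T) (∑ t ∈ T, d t + r) x = d x := by
    intro x hx
    have : x ≠ top T := fun e => (Finset.mem_sdiff.1 hx).2 (e ▸ hmem)
    simp [this]
  rw [Finset.sum_congr rfl this]
  simp
  ring

lemma signExp_nested (m r : ℤ) {X U T : Finset ℕ} (hUX : U ⊆ X) (hTU : T ⊆ U)
    (hT : T.Nonempty) (d : ℕ → ℤ) :
    signExp r X T d + signExp m (contract X T) (contract U T)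
        (Function.update d (top T) (∑ t ∈ T, d t + r))
      = signExp (m + r) X U d + signExp r U T d := by
  have hmem := top_mem hT
  have hle : top T ≤ top U := le_top (hTU hmem)
  have h1 : signExp r X T d = signExp r U T d +
      ∑ x ∈ (X \ U).filter (· < top U),
        if x < top T then d x * (r + ∑ t ∈ T.filter (· < x), d t) else 0 := by
    unfold signExp
    rw [← Finset.sum_filter, Finset.filter_filter, ← Finset.sum_union]
    · refine Finset.sum_congr ?_ fun _ _ => rfl
      ext x
      simp only [Finset.mem_filter, Finset.mem_sdiff, Finset.mem_union]
      have := @hUX x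
      have := @hTU x
      by_cases hx : x < top T
      · have : x < top U := by omega
        tauto
      · tauto
    · rw [Finset.disjoint_left]
      intro x
      simp only [Finset.mem_filter, Finset.mem_sdiff]
      tauto
  have h2 : signExp m (contract X T) (contract U T)
        (Function.update d (top T) (∑ t ∈ T, d t + r))
      = ∑ x ∈ (X \ U).filter (· < top U), d x * (m + (∑ t ∈ (U \ T).filter (· < x), d t +
          if x < top T then 0 else ∑ t ∈ T, d t + r)) := by
    unfold signExp
    rw [top_contract hTU hT]
    have hset : contract X T \ contract U T = X \ U := by
      ext x
      simp only [contract, Finset.mem_insert, Finset.mem_sdiff]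
      have := @hTU x
      have := hTU hmem
      by_cases hx : x = top T
      · subst hx; tauto
      · tauto
    rw [hset]
    refine Finset.sum_congr rfl fun x hx => ?_
    simp only [Finset.mem_filter, Finset.mem_sdiff] at hx
    have hne : x ≠ top T := fun e => hx.1.2 (e ▸ hTU hmem)
    rw [Function.update_of_ne hne]
    congr 2
    have hs : ∀ y ∈ (U \ T).filter (· < x),
        Function.update d (top T) (∑ t ∈ T, d t + r) y = d y := by
      intro y hy
      simp only [Finset.mem_filter, Finset.mem_sdiff] at hy
      have : y ≠ top T := fun e => hy.1.2 (e ▸ hmem)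
      simp [this]
    by_cases hxt : x < top T
    · rw [contract, Finset.filter_insert, if_neg (by omega), Finset.sum_congr rfl hs]
      simp [hxt]
    · rw [contract, Finset.filter_insert, if_pos (by omega), Finset.sum_insert (by simp [hmem]),
        Finset.sum_congr rfl hs]
      simp [hxt]
      ring
  rw [h1, h2, add_assoc, add_comm (signExp (m + r) X U d)]
  congr 1
  rw [← Finset.sum_add_distrib]
  unfold signExp
  refine Finset.sum_congr rfl fun x hx => ?_
  have hU : ∑ t ∈ U.filter (· < x), d t
      = ∑ t ∈ (U \ T).filter (· < x), d t + ∑ t ∈ T.filter (· < x), d t := by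
    rw [← Finset.sum_union]
    · rw [← Finset.filter_union, Finset.sdiff_union_of_subset hTU]
    · exact Finset.disjoint_filter_filter Finset.sdiff_disjoint
  rw [hU]
  by_cases hxt : x < top T
  · simp only [hxt, if_true]
    ring
  · have hTx : T.filter (· < x) = T := by
      refine Finset.filter_true_of_mem fun t ht => ?_
      have h1 := le_top ht
      simp only [Finset.mem_filter, Finset.mem_sdiff] at hx
      have : x ≠ top T := fun e => hx.1.2 (e ▸ hTU hmem)
      omega
    simp only [hxt, if_false, hTx]
    ring

lemma signExp_contract_of_lt (m r : ℤ) {X T S : Finset ℕ} (hTX : T ⊆ X) (hT : T.Nonempty)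
    (hTS : Disjoint T S) (hlt : top T < top S) (d : ℕ → ℤ) :
    signExp m (contract X T) S (Function.update d (top T) (∑ t ∈ T, d t + r))
        + ∑ x ∈ T, d x * (m + ∑ s ∈ S.filter (· < x), d s)
      = signExp m X S d
        + (∑ t ∈ T, d t + r) * (m + ∑ s ∈ S.filter (· < top T), d s) := by
  have hmem := top_mem hT
  have hnS : ∀ x ∈ T, x ∉ S := fun x hx hS => (Finset.disjoint_left.1 hTS) hx hS
  have hsum : ∀ x, ∑ s ∈ S.filter (· < x),
      Function.update d (top T) (∑ t ∈ T, d t + r) s = ∑ s ∈ S.filter (· < x), d s := by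
    intro x
    refine Finset.sum_congr rfl fun s hs => ?_
    have : s ≠ top T := fun e => hnS _ hmem (e ▸ (Finset.mem_filter.1 hs).1)
    simp [this]
  have hset : (contract X T \ S).filter (· < top S)
      = insert (top T) (((X \ S).filter (· < top S)) \ T) := by
    ext x
    simp only [contract, Finset.mem_filter, Finset.mem_sdiff, Finset.mem_insert]
    have := hnS _ hmem
    by_cases hx : x = top T
    · subst hx; tauto
    · tauto
  have hsub : T ⊆ (X \ S).filter (· < top S) := by
    intro x hx
    have := le_top hx
    simp only [Finset.mem_filter, Finset.mem_sdiff]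
    exact ⟨⟨hTX hx, hnS x hx⟩, by omega⟩
  unfold signExp
  rw [hset, Finset.sum_insert (by simp [hmem]), ← Finset.sum_sdiff hsub]
  have hrest : ∀ x ∈ ((X \ S).filter (· < top S)) \ T,
      Function.update d (top T) (∑ t ∈ T, d t + r) x = d x := by
    intro x hx
    have : x ≠ top T := fun e => (Finset.mem_sdiff.1 hx).2 (e ▸ hmem)
    simp [this]
  have hsum' : ∑ x ∈ ((X \ S).filter (· < top S)) \ T,
      Function.update d (top T) (∑ t ∈ T, d t + r) x *
        (m + ∑ s ∈ S.filter (· < x), Function.update d (top T) (∑ t ∈ T, d t + r) s)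
      = ∑ x ∈ ((X \ S).filter (· < top S)) \ T, d x * (m + ∑ s ∈ S.filter (· < x), d s) :=
    Finset.sum_congr rfl fun x hx => by rw [hrest x hx, hsum x]
  rw [hsum', hsum, Function.update_self]
  ring

lemma signExp_contract_of_gt (m r : ℤ) {X T S : Finset ℕ} (hTX : T ⊆ X) (hT : T.Nonempty)
    (hTS : Disjoint T S) (hlt : top S < top T) (d : ℕ → ℤ) :
    signExp m (contract X T) S (Function.update d (top T) (∑ t ∈ T, d t + r))
        + ∑ x ∈ T.filter (· < top S), d x * (m + ∑ s ∈ S.filter (· < x), d s)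
      = signExp m X S d := by
  have hmem := top_mem hT
  have hnS : ∀ x ∈ T, x ∉ S := fun x hx hS => (Finset.disjoint_left.1 hTS) hx hS
  have hsum : ∀ x, ∑ s ∈ S.filter (· < x),
      Function.update d (top T) (∑ t ∈ T, d t + r) s = ∑ s ∈ S.filter (· < x), d s := by
    intro x
    refine Finset.sum_congr rfl fun s hs => ?_
    have : s ≠ top T := fun e => hnS _ hmem (e ▸ (Finset.mem_filter.1 hs).1)
    simp [this]
  have hset : (contract X T \ S).filter (· < top S)
      = ((X \ S).filter (· < top S)) \ (T.filter (· < top S)) := by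
    ext x
    simp only [contract, Finset.mem_filter, Finset.mem_sdiff, Finset.mem_insert]
    have := hnS _ hmem
    by_cases hx : x = top T
    · subst hx
      have : ¬ top T < top S := by omega
      tauto
    · tauto
  have hsub : T.filter (· < top S) ⊆ (X \ S).filter (· < top S) := by
    intro x hx
    simp only [Finset.mem_filter, Finset.mem_sdiff] at hx ⊢
    exact ⟨⟨hTX hx.1, hnS x hx.1⟩, hx.2⟩
  unfold signExp
  rw [hset, ← Finset.sum_sdiff hsub]
  congr 1
  refine Finset.sum_congr rfl fun x hx => ?_
  have : x ≠ top T := by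
    simp only [Finset.mem_filter, Finset.mem_sdiff] at hx
    omega
  rw [hsum x, Function.update_of_ne this]

lemma sum_mul_sum_filter_split (d : ℕ → ℤ) {T S : Finset ℕ} (hTS : Disjoint T S) :
    (∑ t ∈ T, d t) * ∑ s ∈ S.filter (· < top T), d s
      = ∑ t ∈ T, d t * ∑ s ∈ S.filter (· < t), d s
        + ∑ s ∈ S.filter (· < top T), d s * ∑ t ∈ T.filter (· < s), d t := by
  simp only [Finset.mul_sum, Finset.sum_mul]
  have h2 : ∑ s ∈ S.filter (· < top T), ∑ t ∈ T.filter (· < s), d s * d t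
      = ∑ t ∈ T, ∑ s ∈ S.filter (fun s => s < top T ∧ t < s), d t * d s := by
    rw [Finset.sum_comm' (t' := T) (s' := fun t => S.filter (fun s => s < top T ∧ t < s))]
    · exact Finset.sum_congr rfl fun t _ => Finset.sum_congr rfl fun s _ => mul_comm _ _
    · intro s t
      simp only [Finset.mem_filter]
      tauto
  rw [h2, ← Finset.sum_add_distrib, Finset.sum_comm]
  refine Finset.sum_congr rfl fun t ht => ?_
  rw [← Finset.sum_union]
  · refine Finset.sum_congr ?_ fun s _ => rfl
    ext s
    simp only [Finset.mem_filter, Finset.mem_union]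
    have hle := le_top ht
    constructor
    · rintro ⟨hs, hst⟩
      have : s ≠ t := fun e => (Finset.disjoint_left.1 hTS) ht (e ▸ hs)
      rcases lt_or_gt_of_ne this with h | h
      · exact Or.inl ⟨hs, h⟩
      · exact Or.inr ⟨hs, hst, h⟩
    · rintro (⟨hs, h⟩ | ⟨hs, h, _⟩)
      · exact ⟨hs, by omega⟩
      · exact ⟨hs, h⟩
  · rw [Finset.disjoint_left]
    intro s
    simp only [Finset.mem_filter]
    omega

lemma even_signExp_disjoint_of_lt (m r : ℤ) {X T S : Finset ℕ} (hTX : T ⊆ X) (hSX : S ⊆ X)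
    (hT : T.Nonempty) (hS : S.Nonempty) (hTS : Disjoint T S) (hlt : top T < top S)
    (d : ℕ → ℤ) :
    Even (signExp r X T d
        + signExp m (contract X T) S (Function.update d (top T) (∑ t ∈ T, d t + r))
      - (m * r + (signExp m X S d
        + signExp r (contract X S) T (Function.update d (top S) (∑ s ∈ S, d s + m))))) := by
  have h1 := signExp_contract_of_lt m r hTX hT hTS hlt d
  have h2 := signExp_contract_of_gt r m hSX hS hTS.symm hlt d
  have h3 := sum_mul_sum_filter_split d hTS
  simp only [mul_add, Finset.sum_add_distrib, ← Finset.sum_mul, add_mul] at h1 h2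
  refine ⟨∑ s ∈ S.filter (· < top T), d s * ∑ t ∈ T.filter (· < s), d t
    + r * ∑ s ∈ S.filter (· < top T), d s, ?_⟩
  linear_combination h1 - h2 + h3

lemma negOnePow_signExp_disjoint (m r : ℤ) {X T S : Finset ℕ} (hTX : T ⊆ X) (hSX : S ⊆ X)
    (hT : T.Nonempty) (hS : S.Nonempty) (hTS : Disjoint T S) (d : ℕ → ℤ) :
    Int.negOnePow (signExp r X T d
        + signExp m (contract X T) S (Function.update d (top T) (∑ t ∈ T, d t + r)))
      = Int.negOnePow (m * r + (signExp m X S d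
        + signExp r (contract X S) T (Function.update d (top S) (∑ s ∈ S, d s + m)))) := by
  rw [Int.negOnePow_eq_iff]
  rcases lt_trichotomy (top T) (top S) with h | h | h
  · exact even_signExp_disjoint_of_lt m r hTX hSX hT hS hTS h d
  · exact absurd (h ▸ top_mem hS) ((Finset.disjoint_left.1 hTS) (top_mem hT))
  · have := even_signExp_disjoint_of_lt r m hSX hTX hS hT hTS.symm h d
    have h2 : Even (2 * (m * r)) := even_two_mul _
    have h3 := (this.add h2).neg
    refine (congrArg Even ?_).mp h3
    ring

lemma insertAt_nested (m r : ℤ) {Φ : LMap V} (Ψ X' : LMap V) (hΦ : IsLocal Φ)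
    {X U T : Finset ℕ} {A C B : Finset (ℕ × ℕ)} (hTU : T ⊆ U) (hBC : B ⊆ C)
    (hT : T.Nonempty) (d : ℕ → ℤ) (h : ℕ → V) (f : ℕ × ℕ → ℕ) :
    insertAt r (insertAt m Φ Ψ (contract U T) (C \ B)) X' T B X d h A f
      = Φ (contract X U) (Function.update d (top U) (∑ t ∈ U, d t + (m + r)))
          (Function.update h (top U) (insertAt r Ψ X' T B U d h C f)) (A \ C)
          (pushTokens U f) := by
  have hmem := top_mem hT
  simp only [insertAt]
  rw [contract_contract hTU hT, pushTokens_pushTokens hTU hT, top_contract hTU hT,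
    sum_contract hTU hT]
  have hA : (A \ B) \ (C \ B) = A \ C := by
    ext y
    have := @hBC y
    simp only [Finset.mem_sdiff]
    tauto
  rw [hA]
  refine hΦ _ _ _ _ _ _ _ _ (fun x hx => ?_) (fun x hx => ?_) (fun y _ => rfl)
  · by_cases hxU : x = top U
    · subst hxU; simp; ring
    · simp only [contract, Finset.mem_insert, hxU, Finset.mem_sdiff, false_or] at hx
      have : x ≠ top T := fun e => hx.2 (e ▸ hTU hmem)
      simp [hxU, this]
  · by_cases hxU : x = top U
    · subst hxU; simp
    · simp only [contract, Finset.mem_insert, hxU, Finset.mem_sdiff, false_or] at hx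
      have : x ≠ top T := fun e => hx.2 (e ▸ hTU hmem)
      simp [hxU, this]

lemma pushTokens_comm {T S : Finset ℕ} (hT : T.Nonempty) (hS : S.Nonempty)
    (hTS : Disjoint T S) (f : ℕ × ℕ → ℕ) :
    pushTokens S (pushTokens T f) = pushTokens T (pushTokens S f) := by
  funext y
  have h1 : top T ∉ S := Finset.disjoint_left.1 hTS (top_mem hT)
  have h2 : top S ∉ T := Finset.disjoint_right.1 hTS (top_mem hS)
  by_cases hy : f y ∈ T
  · have := Finset.disjoint_left.1 hTS hy
    simp [pushTokens, hy, this, h1]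
  · by_cases hy' : f y ∈ S <;> simp [pushTokens, hy, hy', h2]

lemma contract_comm {X T S : Finset ℕ} (hT : T.Nonempty) (hS : S.Nonempty)
    (hTS : Disjoint T S) :
    contract (contract X T) S = contract (contract X S) T := by
  ext x
  have h1 : top T ∉ S := Finset.disjoint_left.1 hTS (top_mem hT)
  have h2 : top S ∉ T := Finset.disjoint_right.1 hTS (top_mem hS)
  simp only [contract, Finset.mem_insert, Finset.mem_sdiff]
  by_cases hx : x = top T
  · subst hx; tauto
  · by_cases hx' : x = top S
    · subst hx'; tauto
    · tauto

lemma insertAt_local (r : ℤ) {Ψ : LMap V} (X' : LMap V) (hΨ : IsLocal Ψ) {T S : Finset ℕ}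
    {B B' : Finset (ℕ × ℕ)} (hT : T.Nonempty) (hTS : Disjoint T S) (d : ℕ → ℤ) (h : ℕ → V)
    (f : ℕ × ℕ → ℕ) (hB' : ∀ y ∈ B', f y ∈ S) :
    Ψ S (Function.update d (top T) (∑ t ∈ T, d t + r))
      (Function.update h (top T) (X' T d h B f)) B' (pushTokens T f) = Ψ S d h B' f := by
  have h1 : ∀ x ∈ S, x ≠ top T :=
    fun x hx e => Finset.disjoint_left.1 hTS (top_mem hT) (e ▸ hx)
  refine hΨ _ _ _ _ _ _ _ _ (fun x hx => ?_) (fun x hx => ?_) (fun y hy => ?_)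
  · simp [h1 x hx]
  · simp [h1 x hx]
  · simp [pushTokens, Finset.disjoint_right.1 hTS (hB' y hy)]

lemma insertAt_disjoint (m r : ℤ) (Φ : LMap V) {Ψ X' : LMap V} (hΨ : IsLocal Ψ)
    (hX' : IsLocal X') {X T S : Finset ℕ} {A B B' : Finset (ℕ × ℕ)} (hT : T.Nonempty)
    (hS : S.Nonempty) (hTS : Disjoint T S) (d : ℕ → ℤ) (h : ℕ → V) (f : ℕ × ℕ → ℕ)
    (hB : ∀ y ∈ B, f y ∈ T) (hB' : ∀ y ∈ B', f y ∈ S) :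
    insertAt r (insertAt m Φ Ψ S B') X' T B X d h A f
      = insertAt m (insertAt r Φ X' T B) Ψ S B' X d h A f := by
  simp only [insertAt]
  have hne : top T ≠ top S :=
    fun e => Finset.disjoint_left.1 hTS (top_mem hT) (e ▸ top_mem hS)
  have h1 : ∀ x ∈ S, x ≠ top T :=
    fun x hx e => Finset.disjoint_left.1 hTS (top_mem hT) (e ▸ hx)
  have h2 : ∀ x ∈ T, x ≠ top S :=
    fun x hx e => Finset.disjoint_right.1 hTS (top_mem hS) (e ▸ hx)
  rw [insertAt_local r X' hΨ hT hTS d h f hB', insertAt_local m Ψ hX' hS hTS.symm d h f hB,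
    contract_comm hT hS hTS, pushTokens_comm hT hS hTS, Function.update_comm hne,
    Function.update_comm hne]
  have hs1 : ∑ t ∈ S, Function.update d (top T) (∑ t ∈ T, d t + r) t = ∑ t ∈ S, d t :=
    Finset.sum_congr rfl fun t ht => by simp [h1 t ht]
  have hs2 : ∑ t ∈ T, Function.update d (top S) (∑ t ∈ S, d t + m) t = ∑ t ∈ T, d t :=
    Finset.sum_congr rfl fun t ht => by simp [h2 t ht]
  rw [hs1, hs2, sdiff_right_comm]

/-- The signed double insertion: first `X'` at `P`, then `Ψ` at `Q`. -/
def insertTwo (m r : ℤ) (Φ Ψ X' : LMap V) (P Q : Finset ℕ × Finset (ℕ × ℕ)) : LMap V :=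
  fun X d h A f =>
    ((Int.negOnePow (signExp r X P.1 d + signExp m (contract X P.1) Q.1
        (Function.update d (top P.1) (∑ t ∈ P.1, d t + r)))) : ℤ) •
      insertAt r (insertAt m Φ Ψ Q.1 Q.2) X' P.1 P.2 X d h A f

lemma comp_comp_eq (m r : ℤ) (Φ Ψ X' : LMap V) (X : Finset ℕ) (d : ℕ → ℤ) (h : ℕ → V)
    (A : Finset (ℕ × ℕ)) (f : ℕ × ℕ → ℕ) :
    comp r (comp m Φ Ψ) X' X d h A f
      = ∑ P ∈ feeds X A f, ∑ Q ∈ feeds (contract X P.1) (A \ P.2) (pushTokens P.1 f),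
          insertTwo m r Φ Ψ X' P Q X d h A f := by
  rw [comp]
  refine Finset.sum_congr rfl fun P _ => ?_
  rw [insertAt, comp, Finset.smul_sum]
  refine Finset.sum_congr rfl fun Q _ => ?_
  rw [smul_smul, insertTwo, Int.negOnePow_add, Units.val_mul]
  rfl

lemma comp_insert_comp_eq (m r : ℤ) {Φ : LMap V} (Ψ X' : LMap V) (lΦ : IsLocal Φ)
    (hΦ : IsAdditive Φ) (X : Finset ℕ) (d : ℕ → ℤ) (h : ℕ → V)
    (A : Finset (ℕ × ℕ)) (f : ℕ × ℕ → ℕ) :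
    comp (m + r) Φ (comp r Ψ X') X d h A f
      = ∑ R ∈ feeds X A f, ∑ P ∈ feeds R.1 R.2 f,
          insertTwo m r Φ Ψ X' P (contract R.1 P.1, R.2 \ P.2) X d h A f := by
  rw [comp]
  refine Finset.sum_congr rfl fun R hR => ?_
  obtain ⟨hU, hC, hne, hfC⟩ := mem_feeds.1 hR
  have hc : top R.1 ∈ contract X R.1 := by simp [contract]
  rw [insertAt, ← argHom_apply Φ hΦ _ _ _ _ _ _ hc, comp, map_sum, Finset.smul_sum]
  refine Finset.sum_congr rfl fun P hP => ?_
  obtain ⟨hT, hB, hTne, hfB⟩ := mem_feeds.1 hP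
  rw [map_zsmul, smul_smul, argHom_apply, insertTwo,
    insertAt_nested m r Ψ X' lΦ hT hB hTne d h f, signExp_nested m r hU hT hTne,
    Int.negOnePow_add, Units.val_mul]

lemma sum_nested_eq (m r : ℤ) {Φ : LMap V} (Ψ X' : LMap V) (lΦ : IsLocal Φ)
    (hΦ : IsAdditive Φ) (X : Finset ℕ) (d : ℕ → ℤ) (h : ℕ → V)
    (A : Finset (ℕ × ℕ)) (f : ℕ × ℕ → ℕ) :
    ∑ P ∈ feeds X A f, ∑ Q ∈ (feeds (contract X P.1) (A \ P.2) (pushTokens P.1 f)).filter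
        (fun Q => top P.1 ∈ Q.1), insertTwo m r Φ Ψ X' P Q X d h A f
      = comp (m + r) Φ (comp r Ψ X') X d h A f := by
  rw [comp_insert_comp_eq m r Ψ X' lΦ hΦ, Finset.sum_sigma', Finset.sum_sigma']
  have hcon : ∀ (X T S : Finset ℕ), T.Nonempty → S ⊆ contract X T → top T ∈ S →
      contract (S ∪ T) T = S := by
    intro X T S hT hS htop
    ext x
    have := @hS x
    simp only [contract, Finset.mem_insert, Finset.mem_union, Finset.mem_sdiff] at this ⊢
    by_cases hx : x = top T
    · subst hx; tauto
    · tauto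
  refine Finset.sum_bij'
    (fun Z _ => ⟨(Z.2.1 ∪ Z.1.1, Z.2.2 ∪ Z.1.2), Z.1⟩)
    (fun Z _ => ⟨Z.2, (contract Z.1.1 Z.2.1, Z.1.2 \ Z.2.2)⟩) ?_ ?_ ?_ ?_ ?_
  · rintro ⟨⟨T, B⟩, ⟨S, B'⟩⟩ hZ
    simp only [Finset.mem_sigma, mem_feeds, Finset.mem_filter] at hZ ⊢
    obtain ⟨⟨hT, hB, hTne, hfB⟩, ⟨hS, hB', hSne, hfB'⟩, htop⟩ := hZ
    refine ⟨⟨?_, ?_, hSne.mono Finset.subset_union_left, ?_⟩, Finset.subset_union_right,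
      Finset.subset_union_right, hTne, hfB⟩
    · refine Finset.union_subset (fun x hx => ?_) hT
      have := hS hx
      simp only [contract, Finset.mem_insert, Finset.mem_sdiff] at this
      rcases this with rfl | h
      · exact hT (top_mem hTne)
      · exact h.1
    · exact Finset.union_subset (hB'.trans Finset.sdiff_subset) hB
    · intro y hy
      rcases Finset.mem_union.1 hy with hy | hy
      · have := hfB' y hy
        simp only [pushTokens] at this
        split_ifs at this with h
        · exact Finset.mem_union_right _ h
        · exact Finset.mem_union_left _ this
      · exact Finset.mem_union_right _ (hfB y hy)
  · rintro ⟨⟨U, C⟩, ⟨T, B⟩⟩ hZ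
    simp only [Finset.mem_sigma, mem_feeds, Finset.mem_filter] at hZ ⊢
    obtain ⟨⟨hU, hC, hUne, hfC⟩, hT, hB, hTne, hfB⟩ := hZ
    refine ⟨⟨hT.trans hU, hB.trans hC, hTne, hfB⟩, ⟨?_, ?_, by simp [contract], ?_⟩,
      by simp [contract]⟩
    · exact Finset.insert_subset_insert _ (Finset.sdiff_subset_sdiff hU subset_rfl)
    · exact Finset.sdiff_subset_sdiff hC subset_rfl
    · intro y hy
      have := hfC y (Finset.mem_sdiff.1 hy).1
      by_cases h : f y ∈ T <;> simp [pushTokens, contract, h, this]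
  · rintro ⟨⟨T, B⟩, ⟨S, B'⟩⟩ hZ
    simp only [Finset.mem_sigma, mem_feeds, Finset.mem_filter] at hZ
    obtain ⟨⟨hT, hB, hTne, hfB⟩, ⟨hS, hB', hSne, hfB'⟩, htop⟩ := hZ
    have hBB : (B' ∪ B) \ B = B' := by
      rw [Finset.union_sdiff_right]
      exact Finset.sdiff_eq_self_of_disjoint
        (Finset.disjoint_left.2 fun y hy => (Finset.mem_sdiff.1 (hB' hy)).2)
    simp only [hcon X T S hTne hS htop, hBB]
  · rintro ⟨⟨U, C⟩, ⟨T, B⟩⟩ hZ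
    simp only [Finset.mem_sigma, mem_feeds] at hZ
    obtain ⟨⟨hU, hC, hUne, hfC⟩, hT, hB, hTne, hfB⟩ := hZ
    have h1 : contract U T ∪ T = U := by
      rw [contract, Finset.insert_union, Finset.sdiff_union_of_subset hT]
      exact Finset.insert_eq_self.2 (hT (top_mem hTne))
    have h2 : C \ B ∪ B = C := Finset.sdiff_union_of_subset hB
    simp only [h1, h2]
  · rintro ⟨⟨T, B⟩, ⟨S, B'⟩⟩ hZ
    simp only [Finset.mem_sigma, mem_feeds, Finset.mem_filter] at hZ
    obtain ⟨⟨hT, hB, hTne, hfB⟩, ⟨hS, hB', hSne, hfB'⟩, htop⟩ := hZ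
    have hBB : (B' ∪ B) \ B = B' := by
      rw [Finset.union_sdiff_right]
      exact Finset.sdiff_eq_self_of_disjoint
        (Finset.disjoint_left.2 fun y hy => (Finset.mem_sdiff.1 (hB' hy)).2)
    simp only [hcon X T S hTne hS htop, hBB]

lemma disjoint_of_feeds {X T S : Finset ℕ} {A B B' : Finset (ℕ × ℕ)} {f : ℕ × ℕ → ℕ}
    (hB : B ⊆ A)
    (hfB : ∀ y ∈ B, f y ∈ T)
    (hS : S ⊆ contract X T) (hB' : B' ⊆ A \ B) (hfB' : ∀ y ∈ B', pushTokens T f y ∈ S)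
    (htop : top T ∉ S) :
    Disjoint T S ∧ S ⊆ X ∧ B' ⊆ A ∧ B ⊆ A \ B' ∧ (∀ y ∈ B', f y ∈ S) ∧
      ∀ y ∈ B, pushTokens S f y ∈ T := by
  have hSX : ∀ x ∈ S, x ∈ X ∧ x ∉ T := by
    intro x hx
    have := hS hx
    simp only [contract, Finset.mem_insert, Finset.mem_sdiff] at this
    rcases this with rfl | h
    · exact absurd hx htop
    · exact h
  have hBB : ∀ y ∈ B, y ∉ B' := fun y hy hy' => (Finset.mem_sdiff.1 (hB' hy')).2 hy
  refine ⟨Finset.disjoint_right.2 fun x hx => (hSX x hx).2, fun x hx => (hSX x hx).1,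
    hB'.trans Finset.sdiff_subset, fun y hy => Finset.mem_sdiff.2 ⟨hB hy, hBB y hy⟩,
    fun y hy => ?_, fun y hy => ?_⟩
  · have := hfB' y hy
    simp only [pushTokens] at this
    split_ifs at this with h
    · exact absurd this htop
    · exact this
  · have h1 : f y ∉ S := fun h => (hSX _ h).2 (hfB y hy)
    simp [pushTokens, h1, hfB y hy]

lemma sum_disjoint_eq (m r : ℤ) (Φ : LMap V) {Ψ X' : LMap V} (lΨ : IsLocal Ψ)
    (lX' : IsLocal X') (X : Finset ℕ) (d : ℕ → ℤ) (h : ℕ → V)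
    (A : Finset (ℕ × ℕ)) (f : ℕ × ℕ → ℕ) :
    ∑ P ∈ feeds X A f, ∑ Q ∈ (feeds (contract X P.1) (A \ P.2) (pushTokens P.1 f)).filter
        (fun Q => ¬ top P.1 ∈ Q.1), insertTwo m r Φ Ψ X' P Q X d h A f
      = ((Int.negOnePow (m * r)) : ℤ) •
        ∑ P ∈ feeds X A f, ∑ Q ∈ (feeds (contract X P.1) (A \ P.2) (pushTokens P.1 f)).filter
        (fun Q => ¬ top P.1 ∈ Q.1), insertTwo r m Φ X' Ψ P Q X d h A f := by
  have hsub : ∀ {X S T : Finset ℕ}, T ⊆ X → Disjoint T S → T ⊆ contract X S := by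
    intro X S T hT hTS x hx
    simp [contract, hT hx, Finset.disjoint_left.1 hTS hx]
  rw [Finset.sum_sigma', Finset.sum_sigma', Finset.smul_sum]
  refine Finset.sum_bij' (fun Z _ => ⟨Z.2, Z.1⟩) (fun Z _ => ⟨Z.2, Z.1⟩) ?_ ?_
    (fun _ _ => rfl) (fun _ _ => rfl) ?_
  · rintro ⟨⟨T, B⟩, ⟨S, B'⟩⟩ hZ
    simp only [Finset.mem_sigma, mem_feeds, Finset.mem_filter] at hZ ⊢
    obtain ⟨⟨hT, hB, hTne, hfB⟩, ⟨hS, hB', hSne, hfB'⟩, htop⟩ := hZ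
    obtain ⟨h1, h2, h3, h4, h5, h6⟩ := disjoint_of_feeds hB hfB hS hB' hfB' htop
    exact ⟨⟨h2, h3, hSne, h5⟩, ⟨hsub hT h1, h4, hTne, h6⟩,
      Finset.disjoint_right.1 h1 (top_mem hSne)⟩
  · rintro ⟨⟨T, B⟩, ⟨S, B'⟩⟩ hZ
    simp only [Finset.mem_sigma, mem_feeds, Finset.mem_filter] at hZ ⊢
    obtain ⟨⟨hT, hB, hTne, hfB⟩, ⟨hS, hB', hSne, hfB'⟩, htop⟩ := hZ
    obtain ⟨h1, h2, h3, h4, h5, h6⟩ := disjoint_of_feeds hB hfB hS hB' hfB' htop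
    exact ⟨⟨h2, h3, hSne, h5⟩, ⟨hsub hT h1, h4, hTne, h6⟩,
      Finset.disjoint_right.1 h1 (top_mem hSne)⟩
  · rintro ⟨⟨T, B⟩, ⟨S, B'⟩⟩ hZ
    simp only [Finset.mem_sigma, mem_feeds, Finset.mem_filter] at hZ
    obtain ⟨⟨hT, hB, hTne, hfB⟩, ⟨hS, hB', hSne, hfB'⟩, htop⟩ := hZ
    obtain ⟨h1, h2, h3, h4, h5, h6⟩ := disjoint_of_feeds hB hfB hS hB' hfB' htop
    simp only [insertTwo]
    rw [negOnePow_signExp_disjoint m r hT h2 hTne hSne h1 d,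
      insertAt_disjoint m r Φ lΨ lX' hTne hSne h1 d h f hfB h5, Int.negOnePow_add,
      Units.val_mul, smul_smul]

/-- The labelled composition is graded right pre-Lie. -/
lemma comp_preLie (m r : ℤ) {Φ Ψ X' : LMap V} (lΦ : IsLocal Φ) (hΦ : IsAdditive Φ)
    (lΨ : IsLocal Ψ) (lX' : IsLocal X') (X : Finset ℕ) (d : ℕ → ℤ) (h : ℕ → V)
    (A : Finset (ℕ × ℕ)) (f : ℕ × ℕ → ℕ) :
    comp r (comp m Φ Ψ) X' X d h A f - comp (m + r) Φ (comp r Ψ X') X d h A f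
      = ((Int.negOnePow (m * r)) : ℤ) •
        (comp m (comp r Φ X') Ψ X d h A f - comp (m + r) Φ (comp m X' Ψ) X d h A f) := by
  have hsplit : ∀ (m r : ℤ) (Ψ X' : LMap V),
      comp r (comp m Φ Ψ) X' X d h A f - comp (m + r) Φ (comp r Ψ X') X d h A f
      = ∑ P ∈ feeds X A f, ∑ Q ∈ (feeds (contract X P.1) (A \ P.2) (pushTokens P.1 f)).filter
        (fun Q => ¬ top P.1 ∈ Q.1), insertTwo m r Φ Ψ X' P Q X d h A f := by
    intro m r Ψ X'
    rw [comp_comp_eq, ← sum_nested_eq m r Ψ X' lΦ hΦ, sub_eq_iff_eq_add,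
      ← Finset.sum_add_distrib]
    refine Finset.sum_congr rfl fun P _ => ?_
    rw [add_comm, Finset.sum_filter_add_sum_filter_not]
  rw [hsplit, add_comm m r, hsplit, sum_disjoint_eq m r Φ lΨ lX']

lemma comp_sub_left (m : ℤ) (c : ℤ) (Φ Φ' Ψ : LMap V) (X : Finset ℕ) (d : ℕ → ℤ) (h : ℕ → V)
    (A : Finset (ℕ × ℕ)) (f : ℕ × ℕ → ℕ) :
    comp m (Φ - c • Φ') Ψ X d h A f = comp m Φ Ψ X d h A f - c • comp m Φ' Ψ X d h A f := by
  simp only [comp, Finset.smul_sum, ← Finset.sum_sub_distrib]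
  refine Finset.sum_congr rfl fun P _ => ?_
  rw [smul_comm c, ← smul_sub]
  rfl

lemma comp_sub_right (m : ℤ) (c : ℤ) {Φ : LMap V} (hΦ : IsAdditive Φ) (Ψ Ψ' : LMap V)
    (X : Finset ℕ) (d : ℕ → ℤ) (h : ℕ → V) (A : Finset (ℕ × ℕ)) (f : ℕ × ℕ → ℕ) :
    comp m Φ (Ψ - c • Ψ') X d h A f = comp m Φ Ψ X d h A f - c • comp m Φ Ψ' X d h A f := by
  simp only [comp, Finset.smul_sum, ← Finset.sum_sub_distrib]
  refine Finset.sum_congr rfl fun P _ => ?_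
  rw [smul_comm c, ← smul_sub]
  congr 1
  have hc : top P.1 ∈ contract X P.1 := by simp [contract]
  simp only [insertAt]
  rw [← argHom_apply Φ hΦ _ _ _ _ _ _ hc, ← argHom_apply Φ hΦ _ _ _ _ _ _ hc,
    ← argHom_apply Φ hΦ _ _ _ _ _ _ hc, ← map_zsmul, ← map_sub]
  rfl

/-- The labelled graded commutator. -/
def bracket (n m : ℤ) (Φ Ψ : LMap V) : LMap V :=
  comp m Φ Ψ - ((Int.negOnePow (m * n)) : ℤ) • comp n Ψ Φ

lemma bracket_jacobi (n m r : ℤ) {Φ Ψ X' : LMap V} (lΦ : IsLocal Φ) (hΦ : IsAdditive Φ)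
    (lΨ : IsLocal Ψ) (hΨ : IsAdditive Ψ) (lX' : IsLocal X') (hX' : IsAdditive X')
    (X : Finset ℕ) (d : ℕ → ℤ) (h : ℕ → V) (A : Finset (ℕ × ℕ)) (f : ℕ × ℕ → ℕ) :
    bracket n (m + r) Φ (bracket m r Ψ X') X d h A f
      = bracket (n + m) r (bracket n m Φ Ψ) X' X d h A f
        + ((Int.negOnePow (n * m)) : ℤ) •
          bracket m (n + r) Ψ (bracket n r Φ X') X d h A f := by
  have h1 := comp_preLie m r lΦ hΦ lΨ lX' X d h A f
  have h2 := comp_preLie n r lΨ hΨ lΦ lX' X d h A f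
  have h3 := comp_preLie n m lX' hX' lΦ lΨ X d h A f
  simp only [bracket, Pi.sub_apply, Pi.smul_apply, comp_sub_left, comp_sub_right _ _ hΦ,
    comp_sub_right _ _ hΨ, comp_sub_right _ _ hX']
  rw [sub_eq_iff_eq_add] at h1 h2 h3
  simp only [h1, h2, h3]
  simp only [mul_add, add_mul, Int.negOnePow_add, Units.val_mul]
  simp only [mul_comm m n, mul_comm r m, mul_comm r n]
  rcases Int.even_or_odd (n * m) with e1 | e1 <;> rcases Int.even_or_odd (m * r) with e2 | e2 <;>
    rcases Int.even_or_odd (n * r) with e3 | e3 <;>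
    simp only [Int.negOnePow_even, Int.negOnePow_odd, e1, e2, e3, Units.val_one, Units.val_neg,
      mul_one, mul_neg, neg_neg, one_smul, neg_smul, smul_sub, smul_neg,
      add_comm n m] <;> abel

/-- `g 0 < g 1 < ⋯ < g (n - 1)` lists the elements of `X`. -/
structure IsEnum (X : Finset ℕ) (n : ℕ) (g : ℕ → ℕ) : Prop where
  card : X.card = n
  mem : ∀ s, s < n → g s ∈ X
  lt : ∀ s t, s < t → t < n → g s < g t

/-- The increasing enumeration of a finite set of labels. -/
def enum (X : Finset ℕ) (s : ℕ) : ℕ :=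
  if h : s < X.card then X.orderEmbOfFin rfl ⟨s, h⟩ else 0

lemma enum_isEnum (X : Finset ℕ) : IsEnum X X.card (enum X) where
  card := rfl
  mem s hs := by simp [enum, hs]
  lt s t hst ht := by
    have hs : s < X.card := hst.trans ht
    simp only [enum, hs, ht, dif_pos]
    exact (X.orderEmbOfFin rfl).strictMono hst

namespace IsEnum

variable {X : Finset ℕ} {n : ℕ} {g : ℕ → ℕ}

lemma enum_eq (hg : IsEnum X n g) {s : ℕ} (hs : s < n) : enum X s = g s := by
  obtain ⟨rfl, hmem, hlt⟩ := hg
  have := Finset.orderEmbOfFin_unique (s := X) rfl (f := fun i : Fin X.card => g i)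
    (fun i => hmem i i.2) (fun i j hij => hlt i j hij j.2)
  simp only [enum, hs, dif_pos]
  exact (congrFun this ⟨s, hs⟩).symm

lemma injOn (hg : IsEnum X n g) : Set.InjOn g (Finset.range n) := by
  intro s hs t ht hst
  simp only [Finset.coe_range, Set.mem_Iio] at hs ht
  rcases lt_trichotomy s t with h | h | h
  · exact absurd hst (hg.lt s t h ht).ne
  · exact h
  · exact absurd hst (hg.lt t s h hs).ne'

lemma inj (hg : IsEnum X n g) {s t : ℕ} (hs : s < n) (ht : t < n) (h : g s = g t) : s = t :=
  hg.injOn (by simpa using hs) (by simpa using ht) h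

lemma lt_iff (hg : IsEnum X n g) {s t : ℕ} (hs : s < n) (ht : t < n) : g s < g t ↔ s < t := by
  refine ⟨fun h => ?_, fun h => hg.lt s t h ht⟩
  by_contra hst
  rcases (not_lt.1 hst).lt_or_eq with h' | h'
  · exact absurd h (hg.lt t s h' hs).asymm
  · exact absurd h (by simp [h'])

lemma image_eq (hg : IsEnum X n g) : (Finset.range n).image g = X := by
  refine Finset.eq_of_subset_of_card_le (fun x hx => ?_) ?_
  · obtain ⟨s, hs, rfl⟩ := Finset.mem_image.1 hx
    exact hg.mem s (Finset.mem_range.1 hs)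
  · rw [Finset.card_image_of_injOn hg.injOn, hg.card, Finset.card_range]

lemma exists_eq (hg : IsEnum X n g) {x : ℕ} (hx : x ∈ X) : ∃ s < n, g s = x := by
  rw [← hg.image_eq] at hx
  simpa using hx

lemma top_eq (hg : IsEnum X (n + 1) g) : top X = g n := by
  refine top_eq_of (hg.mem n n.lt_succ_self) fun y hy => ?_
  obtain ⟨s, hs, rfl⟩ := hg.exists_eq hy
  rcases (Nat.lt_succ_iff.1 hs).lt_or_eq with h | rfl
  · exact (hg.lt s n h n.lt_succ_self).le
  · exact le_rfl

lemma nonempty (hg : IsEnum X (n + 1) g) : X.Nonempty := ⟨_, hg.mem 0 n.succ_pos⟩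

@[to_additive]
lemma prod_eq {M : Type*} [CommMonoid M] (hg : IsEnum X n g) (F : ℕ → M) :
    ∏ x ∈ X, F x = ∏ s ∈ Finset.range n, F (g s) := by
  rw [← Finset.prod_image (f := F) (g := g) hg.injOn, hg.image_eq]

end IsEnum

lemma shExt_lt {q : ℕ} (σ : Equiv.Perm (Fin q)) {s : ℕ} (hs : s < q) : shExt σ s < q := by
  simp [shExt, hs]

lemma shExt_of_le {q : ℕ} (σ : Equiv.Perm (Fin q)) {s : ℕ} (hs : q ≤ s) : shExt σ s = s := by
  simp [shExt, Nat.not_lt.2 hs]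

lemma shExt_coe {q : ℕ} (σ : Equiv.Perm (Fin q)) (s : Fin q) : shExt σ s = σ s := by
  simp [shExt]

lemma shExt_injective {q : ℕ} (σ : Equiv.Perm (Fin q)) : Function.Injective (shExt σ) := by
  intro s t h
  by_cases hs : s < q <;> by_cases ht : t < q
  · simp only [shExt, hs, ht, dif_pos] at h
    simpa using σ.injective (Fin.ext h)
  · have := shExt_lt σ hs
    rw [h, shExt_of_le σ (Nat.not_lt.1 ht)] at this
    exact absurd this ht
  · have := shExt_lt σ ht
    rw [← h, shExt_of_le σ (Nat.not_lt.1 hs)] at this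
    exact absurd this hs
  · rwa [shExt_of_le σ (Nat.not_lt.1 hs), shExt_of_le σ (Nat.not_lt.1 ht)] at h

section Shuffle

variable {X : Finset ℕ} {k L i : ℕ} {σ : Equiv.Perm (Fin (i + L))}

lemma IsShuffle.left_lt (hσ : IsShuffle i L σ) {s t : ℕ} (hst : s < t) (ht : t < i) :
    shExt σ s < shExt σ t := by
  have h1 : s < i + L := by omega
  have h2 : t < i + L := by omega
  simpa [shExt, h1, h2] using hσ.1 ⟨s, h1⟩ ⟨t, h2⟩ hst ht

lemma IsShuffle.right_lt (hσ : IsShuffle i L σ) {s t : ℕ} (hst : s < t) (ht : t < L + 1) :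
    shExt σ (i + s) < shExt σ (i + t) := by
  have h1 : i + s < i + L := by omega
  rcases (Nat.lt_succ_iff.1 ht).lt_or_eq with h | rfl
  · have h2 : i + t < i + L := by omega
    simpa [shExt, h1, h2] using hσ.2 ⟨i + s, h1⟩ ⟨i + t, h2⟩ (by simpa using hst) (by simp)
  · rw [shExt_of_le σ le_rfl]
    exact shExt_lt σ h1

/-- The labels that the shuffle `σ` feeds to the inner map. -/
def innerLabels (X : Finset ℕ) (i L : ℕ) (σ : Equiv.Perm (Fin (i + L))) : Finset ℕ :=
  (Finset.range (L + 1)).image (fun t => enum X (shExt σ (i + t)))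

lemma shExt_lt_card (hX : X.card = k + L) (hi : i < k) {s : ℕ} (hs : s < i + L + 1) :
    shExt σ s < X.card := by
  rcases (Nat.lt_succ_iff.1 hs).lt_or_eq with h | rfl
  · have := shExt_lt σ h
    omega
  · rw [shExt_of_le σ le_rfl]
    omega

lemma innerLabels_isEnum (hX : X.card = k + L) (hi : i < k) (hσ : IsShuffle i L σ) :
    IsEnum (innerLabels X i L σ) (L + 1) (fun t => enum X (shExt σ (i + t))) := by
  have hlt : ∀ s t, s < t → t < L + 1 →
      enum X (shExt σ (i + s)) < enum X (shExt σ (i + t)) := fun s t hst ht =>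
    (enum_isEnum X).lt _ _ (hσ.right_lt hst ht) (shExt_lt_card hX hi (by omega))
  refine ⟨?_, fun s hs => Finset.mem_image_of_mem _ (Finset.mem_range.2 hs), hlt⟩
  rw [innerLabels, Finset.card_image_of_injOn, Finset.card_range]
  intro s hs t ht hst
  simp only [Finset.coe_range, Set.mem_Iio] at hs ht
  rcases lt_trichotomy s t with h | h | h
  · exact absurd hst (hlt s t h ht).ne
  · exact h
  · exact absurd hst (hlt t s h hs).ne'

lemma innerLabels_subset (hX : X.card = k + L) (hi : i < k) : innerLabels X i L σ ⊆ X := by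
  intro x hx
  obtain ⟨t, ht, rfl⟩ := Finset.mem_image.1 hx
  have := Finset.mem_range.1 ht
  exact (enum_isEnum X).mem _ (shExt_lt_card hX hi (by omega))

lemma top_innerLabels (hX : X.card = k + L) (hi : i < k) (hσ : IsShuffle i L σ) :
    top (innerLabels X i L σ) = enum X (i + L) := by
  rw [(innerLabels_isEnum hX hi hσ).top_eq, shExt_of_le σ le_rfl]

lemma enum_shExt_notMem_innerLabels (hX : X.card = k + L) (hi : i < k) {s : ℕ} (hs : s < i) :
    enum X (shExt σ s) ∉ innerLabels X i L σ := by
  intro h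
  obtain ⟨t, ht, he⟩ := Finset.mem_image.1 h
  have ht := Finset.mem_range.1 ht
  have := shExt_injective σ ((enum_isEnum X).inj (shExt_lt_card hX hi (by omega))
    (shExt_lt_card hX hi (by omega)) he)
  omega

lemma enum_notMem_innerLabels (hX : X.card = k + L) (hi : i < k) {s : ℕ} (hs : i + L < s)
    (hsX : s < X.card) : enum X s ∉ innerLabels X i L σ := by
  intro h
  obtain ⟨t, ht, he⟩ := Finset.mem_image.1 h
  have ht := Finset.mem_range.1 ht
  have := (enum_isEnum X).inj (shExt_lt_card hX hi (by omega)) hsX he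
  rw [← shExt_of_le σ hs.le] at this
  have := shExt_injective σ this
  omega

/-- The labels of `X` outside `innerLabels`, with the largest inner label added, in increasing
order. -/
def outerEnum (X : Finset ℕ) (i L : ℕ) (σ : Equiv.Perm (Fin (i + L))) (s : ℕ) : ℕ :=
  if s < i then enum X (shExt σ s) else enum X (s + L)

lemma contract_isEnum (hX : X.card = k + L) (hi : i < k) (hσ : IsShuffle i L σ) :
    IsEnum (contract X (innerLabels X i L σ)) k (outerEnum X i L σ) := by
  have hT := innerLabels_isEnum hX hi hσ
  have hsub : innerLabels X i L σ ⊆ X := innerLabels_subset hX hi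
  refine ⟨?_, fun s hs => ?_, fun s t hst ht => ?_⟩
  · have h1 := top_mem hT.nonempty
    rw [contract, Finset.card_insert_of_notMem (by simp [h1]), Finset.card_sdiff_of_subset hsub,
      hX, hT.card]
    omega
  · simp only [contract, Finset.mem_insert, Finset.mem_sdiff, outerEnum]
    split_ifs with h
    · exact Or.inr ⟨(enum_isEnum X).mem _ (shExt_lt_card hX hi (by omega)),
        enum_shExt_notMem_innerLabels hX hi h⟩
    · by_cases h' : s = i
      · exact Or.inl (by rw [top_innerLabels hX hi hσ, h'])
      · exact Or.inr ⟨(enum_isEnum X).mem _ (by omega),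
          enum_notMem_innerLabels hX hi (by omega) (by omega)⟩
  · simp only [outerEnum]
    split_ifs with h1 h2 h2
    · exact (enum_isEnum X).lt _ _ (hσ.left_lt hst h2) (shExt_lt_card hX hi (by omega))
    · have := shExt_lt σ (s := s) (by omega)
      exact (enum_isEnum X).lt _ _ (by omega) (by omega)
    · omega
    · exact (enum_isEnum X).lt _ _ (by omega) (by omega)

lemma innerLabels_injective (hX : X.card = k + L) {i' : ℕ} {σ' : Equiv.Perm (Fin (i' + L))}
    (hi : i < k) (hi' : i' < k) (hσ : IsShuffle i L σ) (hσ' : IsShuffle i' L σ')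
    (h : innerLabels X i L σ = innerLabels X i' L σ') :
    (⟨i, σ⟩ : Σ i, Equiv.Perm (Fin (i + L))) = ⟨i', σ'⟩ := by
  have htop := congrArg top h
  rw [top_innerLabels hX hi hσ, top_innerLabels hX hi' hσ'] at htop
  obtain rfl : i = i' := by
    have := (enum_isEnum X).inj (by omega) (by omega) htop
    omega
  congr 1
  ext s
  rw [← shExt_coe, ← shExt_coe]
  refine (enum_isEnum X).inj (shExt_lt_card hX hi (by omega)) (shExt_lt_card hX hi (by omega)) ?_
  by_cases hs : (s : ℕ) < i
  · have h1 := (contract_isEnum hX hi hσ).enum_eq (s := s) (by omega)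
    have h2 := (contract_isEnum hX hi hσ').enum_eq (s := s) (by omega)
    rw [h, h2] at h1
    simpa [outerEnum, hs] using h1.symm
  · have h1 := (innerLabels_isEnum hX hi hσ).enum_eq (s := s - i) (by omega)
    have h2 := (innerLabels_isEnum hX hi hσ').enum_eq (s := s - i) (by omega)
    rw [h, h2] at h1
    have : i + ((s : ℕ) - i) = s := by omega
    simpa [this] using h1.symm

lemma exists_shuffle (S : Finset (Fin (i + L))) (hS : S.card = i) :
    ∃ σ : Equiv.Perm (Fin (i + L)), IsShuffle i L σ ∧ ∀ t : Fin (i + L), i ≤ (t : ℕ) → σ t ∉ S := by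
  have hSc : Sᶜ.card = L := by
    rw [Finset.card_compl, Fintype.card_fin, hS]
    omega
  have hl : ∀ (s : Fin (i + L)) (h : (s : ℕ) < i),
      finSumFinEquiv.symm s = Sum.inl (⟨s, h⟩ : Fin i) := by
    intro s h
    rw [Equiv.symm_apply_eq]
    rfl
  have hr : ∀ (s : Fin (i + L)) (h : i ≤ (s : ℕ)),
      finSumFinEquiv.symm s = Sum.inr (⟨s - i, by omega⟩ : Fin L) := by
    intro s h
    rw [Equiv.symm_apply_eq]
    ext
    simp
    omega
  refine ⟨finSumFinEquiv.symm.trans (finSumEquivOfFinset hS hSc), ⟨?_, ?_⟩, ?_⟩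
  · intro s t hst ht
    have hs : (s : ℕ) < i := lt_trans hst ht
    simp only [Equiv.trans_apply, hl s hs, hl t ht, finSumEquivOfFinset_inl]
    exact (S.orderEmbOfFin hS).strictMono hst
  · intro s t hst hs
    have ht : i ≤ (t : ℕ) := hs.trans (le_of_lt hst)
    simp only [Equiv.trans_apply, hr s hs, hr t ht, finSumEquivOfFinset_inr]
    refine ((Sᶜ).orderEmbOfFin hSc).strictMono ?_
    have : (s : ℕ) < t := hst
    simp only [Fin.mk_lt_mk]
    omega
  · intro t ht
    simp only [Equiv.trans_apply, hr t ht, finSumEquivOfFinset_inr]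
    exact Finset.mem_compl.1 (Finset.orderEmbOfFin_mem _ hSc _)

lemma exists_innerLabels_eq (hX : X.card = k + L) {T : Finset ℕ} (hT : T ⊆ X)
    (hTc : T.card = L + 1) :
    ∃ i < k, ∃ σ : Equiv.Perm (Fin (i + L)), IsShuffle i L σ ∧ innerLabels X i L σ = T := by
  have hTne : T.Nonempty := Finset.card_pos.1 (by omega)
  obtain ⟨q, hq, hqT⟩ := (enum_isEnum X).exists_eq (hT (top_mem hTne))
  have hJc : ((Finset.range q).filter (fun j => enum X j ∈ T)).card = L := by
    have himg : ((Finset.range q).filter (fun j => enum X j ∈ T)).image (enum X)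
        = T.erase (top T) := by
      ext x
      simp only [Finset.mem_image, Finset.mem_filter, Finset.mem_range, Finset.mem_erase]
      constructor
      · rintro ⟨j, ⟨hj, hjT⟩, rfl⟩
        have := (enum_isEnum X).lt j q hj hq
        exact ⟨by omega, hjT⟩
      · rintro ⟨hne, hx⟩
        obtain ⟨j, hj, rfl⟩ := (enum_isEnum X).exists_eq (hT hx)
        refine ⟨j, ⟨?_, hx⟩, rfl⟩
        rw [← (enum_isEnum X).lt_iff hj hq, hqT]
        have := le_top hx
        omega
    rw [← Finset.card_image_of_injOn (f := enum X), himg,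
      Finset.card_erase_of_mem (top_mem hTne), hTc, Nat.add_sub_cancel]
    refine (enum_isEnum X).injOn.mono fun j hj => ?_
    simp only [Finset.coe_filter, Finset.mem_range, Set.mem_ofPred_eq, Finset.coe_range,
      Set.mem_Iio] at hj ⊢
    omega
  have hLq : L ≤ q := by
    rw [← hJc]
    exact (Finset.card_filter_le _ _).trans (by simp)
  obtain ⟨i, rfl⟩ : ∃ i, q = i + L := ⟨q - L, by omega⟩
  have hi : i < k := by omega
  have hScard : ((Finset.univ : Finset (Fin (i + L))).filter
      (fun j : Fin (i + L) => ¬ enum X j ∈ T)).card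
      = i := by
    have h1 := Finset.card_filter_add_card_filter_not (s := (Finset.univ : Finset (Fin (i + L))))
      (fun j : Fin (i + L) => enum X j ∈ T)
    have h2 : ((Finset.univ : Finset (Fin (i + L))).filter
        (fun j : Fin (i + L) => enum X j ∈ T)).card = L := by
      refine Eq.trans ?_ hJc
      rw [Finset.card_filter, Finset.card_filter, Finset.sum_range]
    rw [h2, Finset.card_univ, Fintype.card_fin] at h1
    omega
  obtain ⟨σ, hσ, hσS⟩ := exists_shuffle _ hScard
  refine ⟨i, hi, σ, hσ, Finset.eq_of_subset_of_card_le (fun x hx => ?_) ?_⟩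
  · obtain ⟨t, ht, rfl⟩ := Finset.mem_image.1 hx
    rcases (Nat.lt_succ_iff.1 (Finset.mem_range.1 ht)).lt_or_eq with h | rfl
    · have := hσS ⟨i + t, by omega⟩ (by simp)
      simp only [Finset.mem_filter, Finset.mem_univ, true_and, not_not] at this
      rwa [← shExt_coe] at this
    · rw [shExt_of_le σ le_rfl, hqT]
      exact top_mem hTne
  · rw [(innerLabels_isEnum hX hi hσ).card, hTc]

lemma sum_shuffles_eq {M : Type*} [AddCommMonoid M] (hX : X.card = k + L) (F : Finset ℕ → M) :
    ∑ i ∈ Finset.range k, ∑ σ ∈ Finset.univ.filter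
        (fun σ : Equiv.Perm (Fin (i + L)) => IsShuffle i L σ), F (innerLabels X i L σ)
      = ∑ T ∈ X.powersetCard (L + 1), F T := by
  rw [Finset.sum_sigma']
  refine Finset.sum_bij (fun Z _ => innerLabels X Z.1 L Z.2) ?_ ?_ ?_ (fun _ _ => rfl)
  · rintro ⟨i, σ⟩ hZ
    simp only [Finset.mem_sigma, Finset.mem_range, Finset.mem_filter, Finset.mem_univ,
      true_and] at hZ
    exact Finset.mem_powersetCard.2
      ⟨innerLabels_subset hX hZ.1, (innerLabels_isEnum hX hZ.1 hZ.2).card⟩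
  · rintro ⟨i, σ⟩ hZ ⟨i', σ'⟩ hZ' h
    simp only [Finset.mem_sigma, Finset.mem_range, Finset.mem_filter, Finset.mem_univ,
      true_and] at hZ hZ'
    exact innerLabels_injective hX hZ.1 hZ'.1 hZ.2 hZ'.2 h
  · intro T hT
    obtain ⟨hT, hTc⟩ := Finset.mem_powersetCard.1 hT
    obtain ⟨i, hi, σ, hσ, h⟩ := exists_innerLabels_eq hX hT hTc
    exact ⟨⟨i, σ⟩, by simp [hi, hσ], h⟩

end Shuffle

lemma negOnePow_sum {ι : Type*} (s : Finset ι) (F : ι → ℤ) :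
    ((Int.negOnePow (∑ z ∈ s, F z)) : ℤ) = ∏ z ∈ s, ((Int.negOnePow (F z)) : ℤ) := by
  induction s using Finset.induction_on with
  | empty => simp
  | insert a s ha ih =>
    rw [Finset.sum_insert ha, Finset.prod_insert ha, Int.negOnePow_add, Units.val_mul, ih]

lemma koszul_eq {i L : ℕ} {σ : Equiv.Perm (Fin (i + L))} (hσ : IsShuffle i L σ) (δ : ℕ → ℤ) :
    koszul δ σ = ((Int.negOnePow (∑ s ∈ Finset.range i, ∑ t ∈ (Finset.range L).filter
      (fun t => shExt σ (i + t) < shExt σ s), δ (shExt σ s) * δ (shExt σ (i + t)))) : ℤ) := by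
  rw [Finset.sum_sigma', negOnePow_sum, koszul]
  have hinv : ∀ p : Fin (i + L) × Fin (i + L), p.1 < p.2 → σ p.2 < σ p.1 →
      (p.1 : ℕ) < i ∧ i ≤ (p.2 : ℕ) := by
    intro p h1 h2
    constructor
    · by_contra h
      exact absurd h2 (hσ.2 _ _ h1 (not_lt.1 h)).asymm
    · by_contra h
      exact absurd h2 (hσ.1 _ _ h1 (not_le.1 h)).asymm
  refine Finset.prod_bij (fun p _ => (⟨(p.1 : ℕ), (p.2 : ℕ) - i⟩ : Σ _ : ℕ, ℕ)) ?_ ?_ ?_ ?_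
  · rintro p hp
    simp only [Finset.mem_filter, Finset.mem_univ, true_and] at hp
    obtain ⟨h1, h2⟩ := hinv p hp.1 hp.2
    have h3 : i + ((p.2 : ℕ) - i) = p.2 := by omega
    simp only [Finset.mem_sigma, Finset.mem_range, Finset.mem_filter, h3, shExt_coe]
    exact ⟨h1, by omega, hp.2⟩
  · rintro p hp p' hp' h
    simp only [Finset.mem_filter, Finset.mem_univ, true_and] at hp hp'
    have h1 := hinv p hp.1 hp.2
    have h2 := hinv p' hp'.1 hp'.2
    simp only [Sigma.mk.injEq, heq_eq_eq] at h
    ext <;> omega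
  · rintro ⟨s, t⟩ hz
    simp only [Finset.mem_sigma, Finset.mem_range, Finset.mem_filter] at hz
    obtain ⟨hs, ht, hst⟩ := hz
    refine ⟨(⟨s, by omega⟩, ⟨i + t, by omega⟩), ?_, by simp⟩
    have h1 : s < i + L := by omega
    simp only [shExt, h1, dif_pos, Nat.add_lt_add_left ht i] at hst
    simp only [Finset.mem_filter, Finset.mem_univ, true_and]
    exact ⟨by simp only [Fin.mk_lt_mk]; omega, hst⟩
  · rintro p hp
    simp only [Finset.mem_filter, Finset.mem_univ, true_and] at hp
    have h1 := hinv p hp.1 hp.2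
    have h3 : i + ((p.2 : ℕ) - i) = p.2 := by omega
    simp only [h3, shExt_coe]

lemma signExp_innerLabels (m : ℤ) {X : Finset ℕ} {k L i : ℕ} {σ : Equiv.Perm (Fin (i + L))}
    (hX : X.card = k + L) (hi : i < k) (hσ : IsShuffle i L σ) (d : ℕ → ℤ) :
    signExp m X (innerLabels X i L σ) d
      = ∑ s ∈ Finset.range i, d (enum X (shExt σ s)) * (m + ∑ t ∈ (Finset.range L).filter
          (fun t => shExt σ (i + t) < shExt σ s), d (enum X (shExt σ (i + t)))) := by
  have hset : (X \ innerLabels X i L σ).filter (· < top (innerLabels X i L σ))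
      = (Finset.range i).image (fun s => enum X (shExt σ s)) := by
    rw [top_innerLabels hX hi hσ]
    ext x
    simp only [Finset.mem_filter, Finset.mem_sdiff, Finset.mem_image, Finset.mem_range]
    constructor
    · rintro ⟨⟨hx, hxT⟩, hlt⟩
      obtain ⟨j, hj, rfl⟩ := (enum_isEnum X).exists_eq hx
      have hj' : j < i + L := ((enum_isEnum X).lt_iff hj (by omega)).1 hlt
      have hs : shExt σ (σ.symm ⟨j, hj'⟩) = j := by rw [shExt_coe]; simp
      refine ⟨σ.symm ⟨j, hj'⟩, ?_, by rw [hs]⟩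
      by_contra h
      refine hxT (Finset.mem_image.2 ⟨(σ.symm ⟨j, hj'⟩ : ℕ) - i, ?_, ?_⟩)
      · simp only [Finset.mem_range]
        omega
      · have : i + ((σ.symm ⟨j, hj'⟩ : ℕ) - i) = σ.symm ⟨j, hj'⟩ := by omega
        rw [this, hs]
    · rintro ⟨s, hs, rfl⟩
      have := shExt_lt σ (s := s) (by omega)
      exact ⟨⟨(enum_isEnum X).mem _ (by omega), enum_shExt_notMem_innerLabels hX hi hs⟩,
        (enum_isEnum X).lt _ _ this (by omega)⟩
  rw [signExp, hset, Finset.sum_image]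
  · refine Finset.sum_congr rfl fun s hs => ?_
    have hs := Finset.mem_range.1 hs
    have hs' := shExt_lt σ (s := s) (by omega)
    congr 2
    rw [Finset.sum_filter, (innerLabels_isEnum hX hi hσ).sum_eq, Finset.sum_range_succ,
      Finset.sum_filter, shExt_of_le σ le_rfl, if_neg, add_zero]
    · refine Finset.sum_congr rfl fun t ht => ?_
      have ht := Finset.mem_range.1 ht
      have ht' := shExt_lt σ (s := i + t) (by omega)
      simp only [(enum_isEnum X).lt_iff (s := shExt σ (i + t)) (t := shExt σ s) (by omega)
        (by omega)]
    · exact ((enum_isEnum X).lt _ _ hs' (by omega)).asymm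
  · intro s hs t ht hst
    simp only [Finset.coe_range, Set.mem_Iio] at hs ht
    exact shExt_injective σ ((enum_isEnum X).inj (shExt_lt_card hX hi (by omega))
      (shExt_lt_card hX hi (by omega)) hst)

lemma koszul_mul_eq (m : ℤ) {X : Finset ℕ} {k L i : ℕ} {σ : Equiv.Perm (Fin (i + L))}
    (hX : X.card = k + L) (hi : i < k) (hσ : IsShuffle i L σ) {d δ : ℕ → ℤ}
    (hδ : ∀ s < X.card, δ s = d (enum X s)) :
    koszul δ σ * ((Int.negOnePow (m * ∑ s ∈ Finset.range i, δ (shExt σ s))) : ℤ)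
      = ((Int.negOnePow (signExp m X (innerLabels X i L σ) d)) : ℤ) := by
  rw [koszul_eq hσ, ← Units.val_mul, ← Int.negOnePow_add, signExp_innerLabels m hX hi hσ,
    Finset.mul_sum, ← Finset.sum_add_distrib]
  congr 2
  refine Finset.sum_congr rfl fun s hs => ?_
  have hs := Finset.mem_range.1 hs
  rw [mul_add, Finset.mul_sum, hδ _ (shExt_lt_card hX hi (by omega)), mul_comm m, add_comm]
  congr 1
  refine Finset.sum_congr rfl fun t ht => ?_
  have ht := Finset.mem_range.1 (Finset.mem_filter.1 ht).1
  rw [hδ _ (shExt_lt_card hX hi (by omega))]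

/-- The number of tokens on the label `x`. -/
def tokenCount (A : Finset (ℕ × ℕ)) (f : ℕ × ℕ → ℕ) (x : ℕ) : ℕ := (A.filter (f · = x)).card

lemma card_token_choices {L : ℕ} (A : Finset (ℕ × ℕ)) (f : ℕ × ℕ → ℕ)
    {g : Fin L → ℕ} (hg : Function.Injective g) (b : Fin L → ℕ) :
    (((A.filter (fun y => ∃ t, f y = g t)).powerset).filter
      (fun B => (fun t => tokenCount B f (g t)) = b)).card
      = ∏ t, (tokenCount A f (g t)).choose (b t) := by
  have hcard : ∏ t, (tokenCount A f (g t)).choose (b t)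
      = (Fintype.piFinset fun t => (A.filter (f · = g t)).powersetCard (b t)).card := by
    simp [tokenCount]
  rw [hcard]
  refine Finset.card_bij' (fun B _ t => B.filter (f · = g t))
    (fun c _ => Finset.univ.biUnion c) ?_ ?_ ?_ ?_
  · intro B hB
    simp only [Finset.mem_filter, Finset.mem_powerset] at hB
    simp only [Fintype.mem_piFinset, Finset.mem_powersetCard]
    intro t
    exact ⟨Finset.filter_subset_filter _ (hB.1.trans (Finset.filter_subset _ _)),
      congrFun hB.2 t⟩
  · intro c hc
    simp only [Fintype.mem_piFinset, Finset.mem_powersetCard] at hc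
    simp only [Finset.mem_filter, Finset.mem_powerset]
    refine ⟨fun y hy => ?_, ?_⟩
    · obtain ⟨t, _, hy⟩ := Finset.mem_biUnion.1 hy
      have := Finset.mem_filter.1 ((hc t).1 hy)
      exact Finset.mem_filter.2 ⟨this.1, t, this.2⟩
    · funext t
      rw [← (hc t).2, tokenCount]
      congr 1
      ext y
      simp only [Finset.mem_filter, Finset.mem_biUnion, Finset.mem_univ, true_and]
      constructor
      · rintro ⟨⟨t', hy⟩, hft⟩
        have := (Finset.mem_filter.1 ((hc t').1 hy)).2
        rwa [hg (hft.symm.trans this)]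
      · intro hy
        exact ⟨⟨t, hy⟩, (Finset.mem_filter.1 ((hc t).1 hy)).2⟩
  · intro B hB
    simp only [Finset.mem_filter, Finset.mem_powerset] at hB
    ext y
    simp only [Finset.mem_filter, Finset.mem_biUnion, Finset.mem_univ, true_and]
    constructor
    · rintro ⟨t, hy, _⟩
      exact hy
    · intro hy
      obtain ⟨t, ht⟩ := (Finset.mem_filter.1 (hB.1 hy)).2
      exact ⟨t, hy, ht⟩
  · intro c hc
    simp only [Fintype.mem_piFinset, Finset.mem_powersetCard] at hc
    funext t
    ext y
    simp only [Finset.mem_filter, Finset.mem_biUnion, Finset.mem_univ, true_and]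
    constructor
    · rintro ⟨⟨t', hy⟩, hft⟩
      have := (Finset.mem_filter.1 ((hc t').1 hy)).2
      rwa [hg (hft.symm.trans this)]
    · intro hy
      exact ⟨⟨t, hy⟩, (Finset.mem_filter.1 ((hc t).1 hy)).2⟩

/-- A sum over sets of tokens that only sees the token counts is a sum over exponent vectors. -/
lemma sum_token_choices {M : Type*} {L : ℕ} [AddCommMonoid M] (A : Finset (ℕ × ℕ))
    (f : ℕ × ℕ → ℕ) {g : Fin L → ℕ} (hg : Function.Injective g) (F : (Fin L → ℕ) → M) :
    ∑ B ∈ (A.filter (fun y => ∃ t, f y = g t)).powerset, F (fun t => tokenCount B f (g t))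
      = ∑ b ∈ Fintype.piFinset (fun t => Finset.range (tokenCount A f (g t) + 1)),
          (∏ t, (tokenCount A f (g t)).choose (b t)) • F b := by
  rw [← Finset.sum_fiberwise_of_maps_to (g := fun B t => tokenCount B f (g t))
    (t := Fintype.piFinset (fun t => Finset.range (tokenCount A f (g t) + 1)))]
  · refine Finset.sum_congr rfl fun b _ => ?_
    rw [← card_token_choices A f hg b, ← Finset.sum_const]
    refine Finset.sum_congr rfl fun B hB => ?_
    rw [(Finset.mem_filter.1 hB).2]
  · intro B hB
    simp only [Fintype.mem_piFinset, Finset.mem_range, Nat.lt_succ_iff]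
    exact fun t => Finset.card_le_card (Finset.filter_subset_filter _
      ((Finset.mem_powerset.1 hB).trans (Finset.filter_subset _ _)))

/-- `φ` depends only on its first `k` degrees and arguments and first `k - 1` exponents, and is
additive in each of the arguments. -/
structure IsNice (k : ℕ) (φ : AMap V) : Prop where
  congr : ∀ {d d' h h' a a'}, (∀ j, j < k → d j = d' j) → (∀ j, j < k → h j = h' j) →
    (∀ j, j < k - 1 → a j = a' j) → φ d h a = φ d' h' a'
  add : ∀ d h a j, j < k → ∀ u v : V, φ d (Function.update h j (u + v)) a
    = φ d (Function.update h j u) a + φ d (Function.update h j v) a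

lemma IsNice.nsmul {k : ℕ} {φ : AMap V} (hφ : IsNice k φ) (d : ℕ → ℤ) (h : ℕ → V) (a : ℕ → ℕ)
    {j : ℕ} (hj : j < k) (N : ℕ) (u : V) :
    φ d (Function.update h j (N • u)) a = N • φ d (Function.update h j u) a :=
  map_nsmul (AddMonoidHom.mk' (fun u => φ d (Function.update h j u) a) (hφ.add d h a j hj)) N u

/-- The labelled map defined by a family of maps: the coefficient of `∏ λ_x ^ a_x` is multiplied
by `∏ a_x !`. -/
def lift (φ : ℕ → AMap V) : LMap V := fun X d h A f =>
  if X.Nonempty ∧ tokenCount A f (top X) = 0 then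
    (∏ x ∈ X, (tokenCount A f x).factorial) •
      φ X.card (fun s => d (enum X s)) (fun s => h (enum X s))
        (fun s => tokenCount A f (enum X s))
  else 0

lemma lift_of_ne (φ : ℕ → AMap V) {X : Finset ℕ} (d : ℕ → ℤ) (h : ℕ → V) {A : Finset (ℕ × ℕ)}
    {f : ℕ × ℕ → ℕ} (h0 : tokenCount A f (top X) ≠ 0) : lift φ X d h A f = 0 :=
  if_neg fun hX => h0 hX.2

lemma lift_apply {φ : ℕ → AMap V} {X : Finset ℕ} {n : ℕ} {g : ℕ → ℕ} (hφ : IsNice (n + 1) (φ (n + 1)))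
    (hg : IsEnum X (n + 1) g) {d δ : ℕ → ℤ} {h η : ℕ → V} {A : Finset (ℕ × ℕ)} {f : ℕ × ℕ → ℕ}
    {α : ℕ → ℕ} (h0 : tokenCount A f (top X) = 0) (hδ : ∀ s < n + 1, δ s = d (g s))
    (hη : ∀ s < n + 1, η s = h (g s)) (hα : ∀ s < n, α s = tokenCount A f (g s)) :
    lift φ X d h A f = (∏ x ∈ X, (tokenCount A f x).factorial) • φ (n + 1) δ η α := by
  rw [lift, if_pos ⟨hg.nonempty, h0⟩, hg.card]
  congr 1
  refine hφ.congr (fun s hs => ?_) (fun s hs => ?_) (fun s hs => ?_)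
  · rw [hg.enum_eq hs, hδ s hs]
  · rw [hg.enum_eq hs, hη s hs]
  · rw [hg.enum_eq (by omega), hα s hs]

lemma tokenCount_congr {A : Finset (ℕ × ℕ)} {f f' : ℕ × ℕ → ℕ} (hf : ∀ y ∈ A, f y = f' y)
    (x : ℕ) : tokenCount A f x = tokenCount A f' x := by
  unfold tokenCount
  congr 1
  exact Finset.filter_congr fun y hy => by rw [hf y hy]

lemma enum_card_lt {X : Finset ℕ} {s : ℕ} (hs : s < X.card) : enum X s ∈ X :=
  (enum_isEnum X).mem s hs

lemma lift_isLocal {φ : ℕ → AMap V} (hφ : ∀ k, 1 ≤ k → IsNice k (φ k)) : IsLocal (lift φ) := by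
  intro X d d' h h' A f f' hd hh hf
  simp only [lift, tokenCount_congr hf]
  split_ifs with hX
  · congr 1
    exact (hφ _ (Finset.card_pos.2 hX.1)).congr (fun s hs => hd _ (enum_card_lt hs))
      (fun s hs => hh _ (enum_card_lt hs)) (fun _ _ => rfl)
  · rfl

lemma lift_isAdditive {φ : ℕ → AMap V} (hφ : ∀ k, 1 ≤ k → IsNice k (φ k)) :
    IsAdditive (lift φ) := by
  intro X d h A f x hx u v
  simp only [lift]
  split_ifs with hX
  · rw [← smul_add]
    congr 1
    obtain ⟨j, hj, rfl⟩ := (enum_isEnum X).exists_eq hx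
    have hφX := hφ _ (Finset.card_pos.2 hX.1)
    have key : ∀ w : V, φ X.card (fun s => d (enum X s))
        (fun s => Function.update h (enum X j) w (enum X s)) (fun s => tokenCount A f (enum X s))
        = φ X.card (fun s => d (enum X s)) (Function.update (fun s => h (enum X s)) j w)
          (fun s => tokenCount A f (enum X s)) := by
      intro w
      refine hφX.congr (fun _ _ => rfl) (fun s hs => ?_) (fun _ _ => rfl)
      by_cases hsj : s = j
      · subst hsj; simp
      · rw [Function.update_of_ne hsj, Function.update_of_ne]
        exact fun he => hsj ((enum_isEnum X).inj hs hj he)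
    rw [key, key, key]
    exact hφX.add _ _ _ _ hj u v
  · simp

section Insert

variable {X T : Finset ℕ} {A B : Finset (ℕ × ℕ)} {f : ℕ × ℕ → ℕ}

lemma tokenCount_pushTokens_of_notMem (hT : T.Nonempty) (hB : ∀ y ∈ B, f y ∈ T) {x : ℕ}
    (hx : x ∉ T) : tokenCount (A \ B) (pushTokens T f) x = tokenCount A f x := by
  unfold tokenCount
  congr 1
  ext y
  simp only [Finset.mem_filter, Finset.mem_sdiff]
  unfold pushTokens
  constructor
  · rintro ⟨⟨hy, _⟩, he⟩
    split_ifs at he with hf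
    · exact absurd (he ▸ top_mem hT) hx
    · exact ⟨hy, he⟩
  · rintro ⟨hy, rfl⟩
    exact ⟨⟨hy, fun h => hx (hB y h)⟩, by rw [if_neg hx]⟩

lemma tokenCount_pushTokens_top (hT : T.Nonempty) (hB : B ⊆ A) :
    tokenCount (A \ B) (pushTokens T f) (top T)
      = ∑ x ∈ T, (tokenCount A f x - tokenCount B f x) := by
  have h1 : (A \ B).filter (pushTokens T f · = top T) = (A \ B).filter (f · ∈ T) := by
    refine Finset.filter_congr fun y _ => ?_
    unfold pushTokens
    split_ifs with hf
    · simp [hf]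
    · simp only [hf, iff_false]
      exact fun he => hf (he ▸ top_mem hT)
  have h2 : ∀ y ∈ (A \ B).filter (f · ∈ T), f y ∈ T := fun y hy => (Finset.mem_filter.1 hy).2
  rw [tokenCount, h1, Finset.card_eq_sum_card_fiberwise h2]
  refine Finset.sum_congr rfl fun x hx => ?_
  rw [tokenCount, tokenCount, ← Finset.card_sdiff_of_subset (Finset.filter_subset_filter _ hB)]
  congr 1
  ext y
  simp only [Finset.mem_filter, Finset.mem_sdiff]
  constructor
  · rintro ⟨⟨⟨h1, h2⟩, _⟩, rfl⟩
    exact ⟨⟨h1, rfl⟩, fun h => h2 h.1⟩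
  · rintro ⟨⟨h1, rfl⟩, h2⟩
    exact ⟨⟨⟨h1, fun h => h2 ⟨h, rfl⟩⟩, hx⟩, rfl⟩

variable {k L i : ℕ} {σ : Equiv.Perm (Fin (i + L))}

lemma outerEnum_ne (hX : X.card = k + L) (hi : i < k) {s : ℕ} (hs : s < k) (hsi : s ≠ i) :
    outerEnum X i L σ s ∉ innerLabels X i L σ := by
  unfold outerEnum
  split_ifs with h
  · exact enum_shExt_notMem_innerLabels hX hi h
  · exact enum_notMem_innerLabels hX hi (by omega) (by omega)

/-- The insertion of one lifted map into another, in terms of the original maps. -/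
lemma insertAt_lift (m : ℤ) {φ ψ : ℕ → AMap V} (hφ : IsNice k (φ k))
    (hψ : IsNice (L + 1) (ψ (L + 1))) (hX : X.card = k + L) (hi : i < k)
    (hσ : IsShuffle i L σ) (hT : T = innerLabels X i L σ)
    (hBA : B ⊆ A) (hBT : ∀ y ∈ B, f y ∈ T) (hB0 : tokenCount B f (top T) = 0)
    (hA0 : tokenCount (A \ B) (pushTokens T f) (top (contract X T)) = 0)
    {d δ δI : ℕ → ℤ} {h η ηI : ℕ → V} {α β : ℕ → ℕ}
    (hδI : ∀ t < L + 1, δI t = d (enum X (shExt σ (i + t))))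
    (hηI : ∀ t < L + 1, ηI t = h (enum X (shExt σ (i + t))))
    (hβ : ∀ t < L, β t = tokenCount B f (enum X (shExt σ (i + t))))
    (hδ : ∀ s < k, s ≠ i → δ s = d (outerEnum X i L σ s)) (hδi : δ i = ∑ t ∈ T, d t + m)
    (hη : ∀ s < k, s ≠ i → η s = h (outerEnum X i L σ s))
    (hηi : η i = ψ (L + 1) δI ηI β)
    (hα : ∀ s < k - 1, s ≠ i → α s = tokenCount A f (outerEnum X i L σ s))
    (hαi : i < k - 1 → α i = ∑ x ∈ T, (tokenCount A f x - tokenCount B f x)) :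
    insertAt m (lift φ) (lift ψ) T B X d h A f
      = ((∏ x ∈ X \ T, (tokenCount A f x).factorial) *
          ((∑ x ∈ T, (tokenCount A f x - tokenCount B f x)).factorial *
            ∏ x ∈ T, (tokenCount B f x).factorial)) • φ k δ η α := by
  subst hT
  have hTe := innerLabels_isEnum hX hi hσ
  have hTn := hTe.nonempty
  have hCe := contract_isEnum hX hi hσ
  have hCi : outerEnum X i L σ i = top (innerLabels X i L σ) := by
    rw [top_innerLabels hX hi hσ, outerEnum, if_neg (lt_irrefl i)]
  have hCne : ∀ s < k, s ≠ i → outerEnum X i L σ s ≠ top (innerLabels X i L σ) := by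
    intro s hs hsi he
    rw [← hCi] at he
    exact hsi (hCe.inj hs hi he)
  obtain ⟨K, rfl⟩ : ∃ K, k = K + 1 := ⟨k - 1, by omega⟩
  rw [insertAt, lift_apply (φ := ψ) hψ hTe hB0 hδI hηI hβ,
    lift_apply (φ := φ) hφ hCe hA0 (δ := δ)
      (η := Function.update η i ((∏ x ∈ innerLabels X i L σ, (tokenCount B f x).factorial) •
        ψ (L + 1) δI ηI β)) (α := α),
    hφ.nsmul _ _ _ hi, ← hηi, Function.update_eq_self, smul_smul]
  · congr 1
    rw [contract, Finset.prod_insert (by simp [top_mem hTn]), tokenCount_pushTokens_top hTn hBA,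
      Finset.prod_congr rfl fun x hx => by
        rw [tokenCount_pushTokens_of_notMem hTn hBT (Finset.mem_sdiff.1 hx).2]]
    ring
  · intro s hs
    by_cases hsi : s = i
    · rw [hsi, hδi, hCi, Function.update_self]
    · rw [hδ s hs hsi, Function.update_of_ne (hCne s hs hsi)]
  · intro s hs
    by_cases hsi : s = i
    · rw [hsi, hCi, Function.update_self, Function.update_self]
    · rw [Function.update_of_ne hsi, hη s hs hsi, Function.update_of_ne (hCne s hs hsi)]
  · intro s hs
    by_cases hsi : s = i
    · subst hsi
      rw [hαi hs, hCi, tokenCount_pushTokens_top hTn hBA]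
    · rw [hα s hs hsi,
        tokenCount_pushTokens_of_notMem hTn hBT (outerEnum_ne hX hi (by omega) hsi)]

end Insert

lemma dTerm_of_lt (m : ℤ) {k L i : ℕ} (σ : Equiv.Perm (Fin (i + L))) (φ ψ : AMap V) (d : ℕ → ℤ)
    (h : ℕ → V) (a : ℕ → ℕ) (hi : i + 1 < k) :
    dTerm m k (L + 1) i σ φ ψ d h a
      = ∑ b ∈ Fintype.piFinset (fun t : Fin L => Finset.range (a (shExt σ (i + (t : ℕ))) + 1)),
        (Nat.multinomial Finset.univ (fun t : Fin (L + 1) =>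
          if ht : (t : ℕ) < L then a (shExt σ (i + (t : ℕ))) - b ⟨t, ht⟩ else a (i + L)) : ℤ) •
        φ (fun s => if s < i then d (shExt σ s) else if s = i then
              (∑ t ∈ Finset.range L, d (shExt σ (i + t))) + d (i + L) + m else d (s + L))
          (fun s => if s < i then h (shExt σ s) else if s = i then
              ψ (fun t => if t < L then d (shExt σ (i + t)) else d (i + L))
                (fun t => if t < L then h (shExt σ (i + t)) else h (i + L))
                (fun t => if ht : t < L then b ⟨t, ht⟩ else 0)
            else h (s + L))
          (fun s => if s < i then a (shExt σ s) else if s = i then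
              ∑ t : Fin (L + 1), (if ht : (t : ℕ) < L then a (shExt σ (i + (t : ℕ))) - b ⟨t, ht⟩
                else a (i + L))
            else a (s + L)) :=
  if_pos hi

lemma dTerm_of_not_lt (m : ℤ) {k L i : ℕ} (σ : Equiv.Perm (Fin (i + L))) (φ ψ : AMap V)
    (d : ℕ → ℤ) (h : ℕ → V) (a : ℕ → ℕ) (hi : ¬ i + 1 < k) :
    dTerm m k (L + 1) i σ φ ψ d h a
      = φ (fun s => if s < i then d (shExt σ s) else
              (∑ t ∈ Finset.range L, d (shExt σ (i + t))) + d (i + L) + m)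
          (fun s => if s < i then h (shExt σ s) else
              ψ (fun t => if t < L then d (shExt σ (i + t)) else d (i + L))
                (fun t => if t < L then h (shExt σ (i + t)) else h (i + L))
                (fun t => a (shExt σ (i + t))))
          (fun s => a (shExt σ s)) :=
  if_neg hi

lemma insertAt_lift_of_ne (m : ℤ) {φ : ℕ → AMap V} (hφ : ∀ k, 1 ≤ k → IsNice k (φ k))
    (ψ : ℕ → AMap V) {X T : Finset ℕ} (d : ℕ → ℤ) (h : ℕ → V) {A B : Finset (ℕ × ℕ)}
    {f : ℕ × ℕ → ℕ} (hB : tokenCount B f (top T) ≠ 0) :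
    insertAt m (lift φ) (lift ψ) T B X d h A f = 0 := by
  rw [insertAt, lift_of_ne ψ d h hB, contract,
    ← argHom_apply _ (lift_isAdditive hφ) _ _ _ _ _ _ (Finset.mem_insert_self _ _), map_zero]

lemma tokenCount_filter_of_mem {T : Finset ℕ} (A : Finset (ℕ × ℕ)) (f : ℕ × ℕ → ℕ) {x : ℕ}
    (hx : x ∈ T) : tokenCount (A.filter (f · ∈ T)) f x = tokenCount A f x := by
  unfold tokenCount
  rw [Finset.filter_filter]
  congr 1
  refine Finset.filter_congr fun y _ => ⟨fun h => h.2, fun h => ⟨h ▸ hx, h⟩⟩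

section Term

variable {X : Finset ℕ} {A : Finset (ℕ × ℕ)} {f : ℕ × ℕ → ℕ} {k L i : ℕ}
  {σ : Equiv.Perm (Fin (i + L))} {φ ψ : ℕ → AMap V} {d δ : ℕ → ℤ} {h η : ℕ → V} {α : ℕ → ℕ}

lemma inner_apply {M : Type*} {F F' : ℕ → M} (hX : X.card = k + L) (hi : i < k)
    (hF : ∀ s < X.card, F s = F' (enum X s)) {t : ℕ} (ht : t < L + 1) :
    (if t < L then F (shExt σ (i + t)) else F (i + L)) = F' (enum X (shExt σ (i + t))) := by
  split_ifs with h
  · exact hF _ (shExt_lt_card hX hi (by omega))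
  · obtain rfl : t = L := by omega
    rw [shExt_of_le σ le_rfl, hF _ (by omega)]

lemma sum_innerLabels (hX : X.card = k + L) (hi : i < k) (hσ : IsShuffle i L σ)
    (hδ : ∀ s < X.card, δ s = d (enum X s)) :
    ∑ x ∈ innerLabels X i L σ, d x
      = (∑ t ∈ Finset.range L, δ (shExt σ (i + t))) + δ (i + L) := by
  rw [(innerLabels_isEnum hX hi hσ).sum_eq, Finset.sum_range_succ, shExt_of_le σ le_rfl,
    hδ _ (by omega)]
  congr 1
  refine Finset.sum_congr rfl fun t ht => (hδ _ (shExt_lt_card hX hi ?_)).symm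
  have := Finset.mem_range.1 ht
  omega

lemma factorial_smul_dTerm_last (m : ℤ) (hφ : ∀ k, 1 ≤ k → IsNice k (φ k))
    (hψ : ∀ k, 1 ≤ k → IsNice k (ψ k)) (hX : X.card = k + L) (hi : i + 1 = k)
    (hσ : IsShuffle i L σ) (h0 : tokenCount A f (top X) = 0)
    (hδ : ∀ s < X.card, δ s = d (enum X s)) (hη : ∀ s < X.card, η s = h (enum X s))
    (hα : ∀ s, s + 1 < X.card → α s = tokenCount A f (enum X s)) :
    (∏ x ∈ X, (tokenCount A f x).factorial) • dTerm m k (L + 1) i σ (φ k) (ψ (L + 1)) δ η α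
      = ∑ B ∈ (A.filter (f · ∈ innerLabels X i L σ)).powerset,
          insertAt m (lift φ) (lift ψ) (innerLabels X i L σ) B X d h A f := by
  have hik : i < k := by omega
  have hTe := innerLabels_isEnum hX hik hσ
  have hTn := hTe.nonempty
  have hTX : innerLabels X i L σ ⊆ X := innerLabels_subset hX hik
  have hCe := contract_isEnum hX hik hσ
  have hTX0 : top X = top (innerLabels X i L σ) := by
    have : IsEnum X (i + L + 1) (enum X) := by
      have := enum_isEnum X
      rwa [show X.card = i + L + 1 by omega] at this
    rw [this.top_eq, top_innerLabels hX hik hσ]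
  have hC0 : top (contract X (innerLabels X i L σ)) = top (innerLabels X i L σ) := by
    subst hi
    rw [hCe.top_eq, outerEnum, if_neg (lt_irrefl i), top_innerLabels hX hik hσ]
  rw [Finset.sum_eq_single (A.filter (f · ∈ innerLabels X i L σ))]
  · have hsub : ∑ x ∈ innerLabels X i L σ, (tokenCount A f x
        - tokenCount (A.filter (f · ∈ innerLabels X i L σ)) f x) = 0 :=
      Finset.sum_eq_zero fun x hx => by rw [tokenCount_filter_of_mem A f hx, Nat.sub_self]
    rw [insertAt_lift m (hφ k (by omega)) (hψ (L + 1) (by omega)) hX hik hσ rfl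
      (Finset.filter_subset _ _) (fun y hy => (Finset.mem_filter.1 hy).2)
      (by rw [tokenCount_filter_of_mem A f (top_mem hTn), ← hTX0, h0])
      (by rw [hC0, tokenCount_pushTokens_top hTn (Finset.filter_subset _ _), hsub])
      (δI := fun t => if t < L then δ (shExt σ (i + t)) else δ (i + L))
      (ηI := fun t => if t < L then η (shExt σ (i + t)) else η (i + L))
      (β := fun t => α (shExt σ (i + t)))
      (δ := fun s => if s < i then δ (shExt σ s) else
        (∑ t ∈ Finset.range L, δ (shExt σ (i + t))) + δ (i + L) + m)
      (η := fun s => if s < i then η (shExt σ s) else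
        ψ (L + 1) (fun t => if t < L then δ (shExt σ (i + t)) else δ (i + L))
          (fun t => if t < L then η (shExt σ (i + t)) else η (i + L))
          (fun t => α (shExt σ (i + t))))
      (α := fun s => α (shExt σ s)), dTerm_of_not_lt _ _ _ _ _ _ _ (by omega)]
    · congr 1
      rw [hsub, Nat.factorial_zero, one_mul, ← Finset.prod_sdiff hTX]
      congr 1
      exact Finset.prod_congr rfl fun x hx => by rw [tokenCount_filter_of_mem A f hx]
    · exact fun t ht => inner_apply hX hik hδ ht
    · exact fun t ht => inner_apply hX hik hη ht
    · intro t ht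
      have := shExt_lt σ (s := i + t) (by omega)
      rw [tokenCount_filter_of_mem A f (hTe.mem t (by omega)), hα _ (by omega)]
    · intro s hs hsi
      have : s < i := by omega
      simp only [this, if_true, outerEnum]
      exact hδ _ (shExt_lt_card hX hik (by omega))
    · simp only [lt_irrefl, if_false]
      rw [sum_innerLabels hX hik hσ hδ]
    · intro s hs hsi
      have : s < i := by omega
      simp only [this, if_true, outerEnum]
      exact hη _ (shExt_lt_card hX hik (by omega))
    · simp only [lt_irrefl, if_false]
    · intro s hs hsi
      have : s < i := by omega
      have := shExt_lt σ (s := s) (by omega)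
      rw [outerEnum, if_pos ‹s < i›, hα _ (by omega)]
    · intro h
      omega
  · intro B hB hne
    have hB := Finset.mem_powerset.1 hB
    rw [insertAt, lift_of_ne]
    rw [hC0, tokenCount, Finset.card_ne_zero]
    obtain ⟨y, hy, hyB⟩ := Finset.exists_of_ssubset (hB.ssubset_of_ne hne)
    have hy := Finset.mem_filter.1 hy
    exact ⟨y, Finset.mem_filter.2 ⟨Finset.mem_sdiff.2 ⟨hy.1, hyB⟩, if_pos hy.2⟩⟩
  · intro h
    exact absurd (Finset.mem_powerset_self _) h

lemma multinomial_coefficient_eq (c b : Fin L → ℕ) (hb : ∀ t, b t ≤ c t) (c' : ℕ) :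
    (∏ t, (c t).factorial) * c'.factorial *
        Nat.multinomial Finset.univ (fun t : Fin (L + 1) =>
          if ht : (t : ℕ) < L then c ⟨t, ht⟩ - b ⟨t, ht⟩ else c')
      = (∏ t, (c t).choose (b t)) *
        ((∑ t : Fin (L + 1), if ht : (t : ℕ) < L then c ⟨t, ht⟩ - b ⟨t, ht⟩ else c').factorial *
          ∏ t, (b t).factorial) := by
  rw [← Nat.multinomial_spec, Fin.prod_univ_castSucc]
  have hc : ∏ t, (c t).factorial
      = (∏ t, (c t).choose (b t)) * (∏ t, (b t).factorial) * ∏ t, (c t - b t).factorial := by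
    rw [← Finset.prod_mul_distrib, ← Finset.prod_mul_distrib]
    exact Finset.prod_congr rfl fun t _ => (Nat.choose_mul_factorial_mul_factorial (hb t)).symm
  rw [hc]
  simp only [Fin.val_castSucc, Fin.is_lt, dif_pos, Fin.eta, Fin.val_last, lt_irrefl,
    not_false_eq_true, dif_neg]
  ring

lemma factorial_smul_dTerm_of_lt (m : ℤ) (hφ : ∀ k, 1 ≤ k → IsNice k (φ k))
    (hψ : ∀ k, 1 ≤ k → IsNice k (ψ k)) (hX : X.card = k + L) (hi : i + 1 < k)
    (hσ : IsShuffle i L σ) (h0 : tokenCount A f (top X) = 0)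
    (hδ : ∀ s < X.card, δ s = d (enum X s)) (hη : ∀ s < X.card, η s = h (enum X s))
    (hα : ∀ s, s + 1 < X.card → α s = tokenCount A f (enum X s)) :
    (∏ x ∈ X, (tokenCount A f x).factorial) • dTerm m k (L + 1) i σ (φ k) (ψ (L + 1)) δ η α
      = ∑ B ∈ (A.filter (f · ∈ innerLabels X i L σ)).powerset,
          insertAt m (lift φ) (lift ψ) (innerLabels X i L σ) B X d h A f := by
  have hik : i < k := by omega
  have hTe := innerLabels_isEnum hX hik hσ
  have hTn := hTe.nonempty
  have hTX : innerLabels X i L σ ⊆ X := innerLabels_subset hX hik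
  have hCe := contract_isEnum hX hik hσ
  have hC0 : top (contract X (innerLabels X i L σ)) = top X ∧
      top X ∉ innerLabels X i L σ := by
    obtain ⟨K, rfl⟩ : ∃ K, k = K + 1 := ⟨k - 1, by omega⟩
    have : IsEnum X (K + L + 1) (enum X) := by
      have := enum_isEnum X
      rwa [show X.card = K + L + 1 by omega] at this
    rw [hCe.top_eq, this.top_eq, outerEnum, if_neg (by omega)]
    exact ⟨rfl, enum_notMem_innerLabels hX hik (by omega) (by omega)⟩
  have hαt : ∀ t < L + 1, α (shExt σ (i + t)) = tokenCount A f (enum X (shExt σ (i + t))) := by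
    intro t ht
    refine hα _ ?_
    rcases (Nat.lt_succ_iff.1 ht).lt_or_eq with h | rfl
    · have := shExt_lt σ (s := i + t) (by omega)
      omega
    · rw [shExt_of_le σ le_rfl]
      omega
  have hαL : α (i + L) = tokenCount A f (top (innerLabels X i L σ)) := by
    rw [top_innerLabels hX hik hσ]
    exact hα _ (by omega)
  have hg : Function.Injective (fun t : Fin L => enum X (shExt σ (i + (t : ℕ)))) := by
    intro s t hst
    exact Fin.ext (hTe.inj (by omega) (by omega) hst)
  have hgtop : ∀ t : Fin L, enum X (shExt σ (i + (t : ℕ))) ≠ top (innerLabels X i L σ) := by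
    intro t
    rw [hTe.top_eq]
    exact (hTe.lt t L t.2 (by omega)).ne
  have hsub : (A.filter (fun y => ∃ t : Fin L, f y = enum X (shExt σ (i + (t : ℕ))))).powerset
      ⊆ (A.filter (f · ∈ innerLabels X i L σ)).powerset := by
    refine Finset.powerset_mono.2 fun y hy => ?_
    obtain ⟨hy, t, ht⟩ := Finset.mem_filter.1 hy
    exact Finset.mem_filter.2 ⟨hy, ht ▸ hTe.mem t (by omega)⟩
  have hTprod : ∀ F : ℕ → ℕ, ∏ x ∈ innerLabels X i L σ, F x
      = (∏ t : Fin L, F (enum X (shExt σ (i + (t : ℕ))))) * F (top (innerLabels X i L σ)) := by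
    intro F
    rw [hTe.top_eq, hTe.prod_eq, Finset.prod_range_succ, Finset.prod_range]
  rw [← Finset.sum_subset hsub]
  · obtain ⟨F, hF⟩ : ∃ F : (Fin L → ℕ) → V, ∀ b, F b =
        ((∏ x ∈ X \ innerLabels X i L σ, (tokenCount A f x).factorial) *
          ((∑ t : Fin (L + 1), (if ht : (t : ℕ) < L then α (shExt σ (i + (t : ℕ))) - b ⟨t, ht⟩
                else α (i + L))).factorial * ∏ t, (b t).factorial)) •
          φ k (fun s => if s < i then δ (shExt σ s) else if s = i then
              (∑ t ∈ Finset.range L, δ (shExt σ (i + t))) + δ (i + L) + m else δ (s + L))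
            (fun s => if s < i then η (shExt σ s) else if s = i then
              ψ (L + 1) (fun t => if t < L then δ (shExt σ (i + t)) else δ (i + L))
                (fun t => if t < L then η (shExt σ (i + t)) else η (i + L))
                (fun t => if ht : t < L then b ⟨t, ht⟩ else 0)
              else η (s + L))
            (fun s => if s < i then α (shExt σ s) else if s = i then
              ∑ t : Fin (L + 1), (if ht : (t : ℕ) < L then α (shExt σ (i + (t : ℕ))) - b ⟨t, ht⟩
                else α (i + L))
              else α (s + L)) :=
      ⟨_, fun _ => rfl⟩
    have hterm : ∀ B ∈ (A.filter (fun y => ∃ t : Fin L,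
        f y = enum X (shExt σ (i + (t : ℕ))))).powerset,
        insertAt m (lift φ) (lift ψ) (innerLabels X i L σ) B X d h A f
          = F (fun t => tokenCount B f (enum X (shExt σ (i + (t : ℕ))))) := by
      intro B hB
      have hBA : B ⊆ A := (Finset.mem_powerset.1 hB).trans (Finset.filter_subset _ _)
      have hBT : ∀ y ∈ B, f y ∈ innerLabels X i L σ := fun y hy =>
        (Finset.mem_filter.1 (Finset.mem_powerset.1 (hsub hB) hy)).2
      have hB0 : tokenCount B f (top (innerLabels X i L σ)) = 0 := by
        rw [tokenCount, Finset.card_eq_zero, Finset.filter_eq_empty_iff]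
        intro y hy he
        obtain ⟨t, ht⟩ := (Finset.mem_filter.1 (Finset.mem_powerset.1 hB hy)).2
        exact hgtop t (ht.symm.trans he)
      have hsum : ∑ x ∈ innerLabels X i L σ, (tokenCount A f x - tokenCount B f x)
          = ∑ t : Fin (L + 1), (if (t : ℕ) < L then α (shExt σ (i + (t : ℕ)))
              - tokenCount B f (enum X (shExt σ (i + (t : ℕ)))) else α (i + L)) := by
        rw [Fin.sum_univ_castSucc, hTe.sum_eq, Finset.sum_range_succ, Finset.sum_range]
        simp only [Fin.val_castSucc, Fin.is_lt, if_true, Fin.val_last, lt_irrefl, if_false]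
        rw [← hTe.top_eq, hB0, Nat.sub_zero, hαL]
        congr 1
        exact Finset.sum_congr rfl fun t _ => by rw [hαt t (by omega)]
      rw [hF, insertAt_lift m (hφ k (by omega)) (hψ (L + 1) (by omega)) hX hik hσ rfl hBA hBT hB0
        (by rw [hC0.1, tokenCount_pushTokens_of_notMem hTn hBT hC0.2, h0])
        (fun t ht => inner_apply hX hik hδ ht) (fun t ht => inner_apply hX hik hη ht)
        (β := fun t => if t < L then tokenCount B f (enum X (shExt σ (i + t))) else 0)
        (δ := fun s => if s < i then δ (shExt σ s) else if s = i then
          (∑ t ∈ Finset.range L, δ (shExt σ (i + t))) + δ (i + L) + m else δ (s + L))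
        (η := fun s => if s < i then η (shExt σ s) else if s = i then
              ψ (L + 1) (fun t => if t < L then δ (shExt σ (i + t)) else δ (i + L))
                (fun t => if t < L then η (shExt σ (i + t)) else η (i + L))
                (fun t => if t < L then tokenCount B f (enum X (shExt σ (i + t))) else 0)
              else η (s + L))
        (α := fun s => if s < i then α (shExt σ s) else if s = i then
              ∑ t : Fin (L + 1), (if (t : ℕ) < L then α (shExt σ (i + (t : ℕ)))
              - tokenCount B f (enum X (shExt σ (i + (t : ℕ)))) else α (i + L))
              else α (s + L)), hsum, hTprod, hB0, Nat.factorial_zero, mul_one]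
      · simp only [dite_eq_ite]
      · intro t ht
        simp only [ht, if_true]
      · intro s hs hsi
        unfold outerEnum
        split_ifs with h
        · exact hδ _ (shExt_lt_card hX hik (by omega))
        · exact hδ _ (by omega)
      · simp only [lt_irrefl, if_false, if_true]
        rw [sum_innerLabels hX hik hσ hδ]
      · intro s hs hsi
        unfold outerEnum
        split_ifs with h
        · exact hη _ (shExt_lt_card hX hik (by omega))
        · exact hη _ (by omega)
      · simp only [lt_irrefl, if_false, if_true]
      · intro s hs hsi
        unfold outerEnum
        split_ifs with h
        · have := shExt_lt σ (s := s) (by omega)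
          exact hα _ (by omega)
        · exact hα _ (by omega)
      · intro _
        simp only [lt_irrefl, if_false, if_true]
        rw [hsum]
    refine Eq.trans ?_ ((Finset.sum_congr rfl hterm).trans (sum_token_choices A f hg F)).symm
    rw [dTerm_of_lt _ _ _ _ _ _ _ hi, Finset.smul_sum]
    have hpi : (fun t : Fin L => Finset.range (α (shExt σ (i + (t : ℕ))) + 1))
        = fun t : Fin L => Finset.range (tokenCount A f (enum X (shExt σ (i + (t : ℕ)))) + 1) := by
      funext t
      rw [hαt t (by omega)]
    rw [hpi]
    refine Finset.sum_congr rfl fun b hb => ?_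
    have hb' : ∀ t : Fin L, b t ≤ α (shExt σ (i + (t : ℕ))) := by
      intro t
      have := Fintype.mem_piFinset.1 hb t
      rw [hαt t (by omega)]
      exact Nat.lt_succ_iff.1 (Finset.mem_range.1 this)
    rw [hF, natCast_zsmul, smul_smul, smul_smul]
    congr 1
    have := multinomial_coefficient_eq (fun t : Fin L => α (shExt σ (i + (t : ℕ)))) b hb'
      (α (i + L))
    rw [← Finset.prod_sdiff hTX, hTprod, ← hαL, mul_assoc]
    have hprod : ∀ F : ℕ → ℕ, ∏ t : Fin L, F (tokenCount A f (enum X (shExt σ (i + (t : ℕ)))))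
        = ∏ t : Fin L, F (α (shExt σ (i + (t : ℕ)))) := fun F =>
      Finset.prod_congr rfl fun t _ => by rw [hαt t (by omega)]
    have hchoose : ∏ t : Fin L, (tokenCount A f (enum X (shExt σ (i + (t : ℕ))))).choose (b t)
        = ∏ t : Fin L, (α (shExt σ (i + (t : ℕ)))).choose (b t) :=
      Finset.prod_congr rfl fun t _ => by rw [hαt t (by omega)]
    rw [hprod, this, hchoose]
    ring
  · intro B hB hB'
    refine insertAt_lift_of_ne m hφ ψ d h fun h0 => hB' ?_
    rw [tokenCount, Finset.card_eq_zero, Finset.filter_eq_empty_iff] at h0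
    refine Finset.mem_powerset.2 fun y hy => ?_
    obtain ⟨hyA, hyT⟩ := Finset.mem_filter.1 (Finset.mem_powerset.1 hB hy)
    refine Finset.mem_filter.2 ⟨hyA, ?_⟩
    obtain ⟨t, ht, he⟩ := hTe.exists_eq hyT
    refine ⟨⟨t, ?_⟩, he.symm⟩
    by_contra hL
    obtain rfl : t = L := by omega
    exact h0 hy (by rw [hTe.top_eq, he])

end Term

lemma sum_Icc_reflect {M : Type*} [AddCommMonoid M] (p : ℕ) (F : ℕ → ℕ → M) :
    ∑ k ∈ Finset.Icc 1 p, F (p + 1 - k) k = ∑ k ∈ Finset.Icc 1 p, F k (p + 1 - k) := by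
  refine Finset.sum_nbij' (fun k => p + 1 - k) (fun k => p + 1 - k) ?_ ?_ ?_ ?_ ?_ <;>
    intro k hk <;> have hk := Finset.mem_Icc.1 hk
  · exact Finset.mem_Icc.2 (by omega)
  · exact Finset.mem_Icc.2 (by omega)
  · omega
  · omega
  · rw [show p + 1 - (p + 1 - k) = k by omega]

lemma comp_eq_sum_powersetCard (m : ℤ) (Φ Ψ : LMap V) (X : Finset ℕ) (d : ℕ → ℤ) (h : ℕ → V)
    (A : Finset (ℕ × ℕ)) (f : ℕ × ℕ → ℕ) :
    comp m Φ Ψ X d h A f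
      = ∑ l ∈ Finset.Icc 1 X.card, ∑ T ∈ X.powersetCard l,
          ((Int.negOnePow (signExp m X T d)) : ℤ) •
            ∑ B ∈ (A.filter (f · ∈ T)).powerset, insertAt m Φ Ψ T B X d h A f := by
  rw [comp, Finset.sum_finset_product (feeds X A f) (X.powerset.filter (·.Nonempty))
    (fun T => (A.filter (f · ∈ T)).powerset),
    ← Finset.sum_fiberwise_of_maps_to (g := Finset.card) (t := Finset.Icc 1 X.card)]
  · refine Finset.sum_congr rfl fun l hl => ?_
    have hl := Finset.mem_Icc.1 hl
    refine Finset.sum_congr ?_ fun T _ => by rw [Finset.smul_sum]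
    ext T
    simp only [Finset.mem_filter, Finset.mem_powerset, Finset.mem_powersetCard]
    constructor
    · rintro ⟨⟨h1, _⟩, h2⟩
      exact ⟨h1, h2⟩
    · rintro ⟨h1, h2⟩
      exact ⟨⟨h1, Finset.card_pos.1 (by omega)⟩, h2⟩
  · intro T hT
    have hT := Finset.mem_filter.1 hT
    exact Finset.mem_Icc.2 ⟨Finset.card_pos.2 hT.2,
      Finset.card_le_card (Finset.mem_powerset.1 hT.1)⟩
  · rintro ⟨T, B⟩
    simp only [mem_feeds, Finset.mem_filter, Finset.mem_powerset, Finset.subset_iff]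
    constructor
    · rintro ⟨h1, h2, h3, h4⟩
      exact ⟨⟨h1, h3⟩, fun y hy => ⟨h2 hy, h4 y hy⟩⟩
    · rintro ⟨⟨h1, h3⟩, h2⟩
      exact ⟨h1, fun y hy => (h2 hy).1, h3, fun y hy => (h2 hy).2⟩

section Bracket

variable {X : Finset ℕ} {A : Finset (ℕ × ℕ)} {f : ℕ × ℕ → ℕ} {φ ψ : ℕ → AMap V}
  {d δ : ℕ → ℤ} {h η : ℕ → V} {α : ℕ → ℕ}

lemma factorial_smul_dia (m : ℤ) (hφ : ∀ k, 1 ≤ k → IsNice k (φ k))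
    (hψ : ∀ k, 1 ≤ k → IsNice k (ψ k)) {k L : ℕ} (hX : X.card = k + L)
    (h0 : tokenCount A f (top X) = 0)
    (hδ : ∀ s < X.card, δ s = d (enum X s)) (hη : ∀ s < X.card, η s = h (enum X s))
    (hα : ∀ s, s + 1 < X.card → α s = tokenCount A f (enum X s)) :
    (∏ x ∈ X, (tokenCount A f x).factorial) • dia m k (L + 1) (φ k) (ψ (L + 1)) δ η α
      = ∑ T ∈ X.powersetCard (L + 1), ((Int.negOnePow (signExp m X T d)) : ℤ) •
          ∑ B ∈ (A.filter (f · ∈ T)).powerset, insertAt m (lift φ) (lift ψ) T B X d h A f := by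
  rw [← sum_shuffles_eq hX, dia, Finset.smul_sum]
  refine Finset.sum_congr rfl fun i hi => ?_
  have hi := Finset.mem_range.1 hi
  rw [Finset.smul_sum]
  refine Finset.sum_congr rfl fun σ hσ => ?_
  have hσ : IsShuffle i L σ := (Finset.mem_filter.1 hσ).2
  rw [smul_comm, ← koszul_mul_eq m hX hi hσ hδ]
  congr 1
  by_cases hik : i + 1 < k
  · exact factorial_smul_dTerm_of_lt m hφ hψ hX hik hσ h0 hδ hη hα
  · exact factorial_smul_dTerm_last m hφ hψ hX (by omega) hσ h0 hδ hη hα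

lemma factorial_smul_sum_dia (m : ℤ) (hφ : ∀ k, 1 ≤ k → IsNice k (φ k))
    (hψ : ∀ k, 1 ≤ k → IsNice k (ψ k)) (h0 : tokenCount A f (top X) = 0)
    (hδ : ∀ s < X.card, δ s = d (enum X s)) (hη : ∀ s < X.card, η s = h (enum X s))
    (hα : ∀ s, s + 1 < X.card → α s = tokenCount A f (enum X s)) :
    (∏ x ∈ X, (tokenCount A f x).factorial) • ∑ l ∈ Finset.Icc 1 X.card,
        dia m (X.card + 1 - l) l (φ (X.card + 1 - l)) (ψ l) δ η α
      = comp m (lift φ) (lift ψ) X d h A f := by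
  rw [comp_eq_sum_powersetCard, Finset.smul_sum]
  refine Finset.sum_congr rfl fun l hl => ?_
  have hl := Finset.mem_Icc.1 hl
  obtain ⟨L, rfl⟩ : ∃ L, l = L + 1 := ⟨l - 1, by omega⟩
  exact factorial_smul_dia m hφ hψ (by omega) h0 hδ hη hα

/-- The bracket of labelled maps computes the bracket of the original maps. -/
lemma factorial_smul_Br (n m : ℤ) (hφ : ∀ k, 1 ≤ k → IsNice k (φ k))
    (hψ : ∀ k, 1 ≤ k → IsNice k (ψ k)) {p : ℕ} (hX : X.card = p)
    (h0 : tokenCount A f (top X) = 0)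
    (hδ : ∀ s < p, δ s = d (enum X s)) (hη : ∀ s < p, η s = h (enum X s))
    (hα : ∀ s, s + 1 < p → α s = tokenCount A f (enum X s)) :
    (∏ x ∈ X, (tokenCount A f x).factorial) • Br n m φ ψ p δ η α
      = bracket n m (lift φ) (lift ψ) X d h A f := by
  subst hX
  have hB : Br n m φ ψ X.card δ η α
      = ∑ l ∈ Finset.Icc 1 X.card, dia m (X.card + 1 - l) l (φ (X.card + 1 - l)) (ψ l) δ η α
        - ((Int.negOnePow (m * n)) : ℤ) • ∑ l ∈ Finset.Icc 1 X.card,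
            dia n (X.card + 1 - l) l (ψ (X.card + 1 - l)) (φ l) δ η α := by
    rw [Br, Finset.sum_sub_distrib, ← Finset.smul_sum,
      sum_Icc_reflect X.card (fun k l => dia m k l (φ k) (ψ l) δ η α)]
  rw [hB, smul_sub, smul_comm, factorial_smul_sum_dia m hφ hψ h0 hδ hη hα,
    factorial_smul_sum_dia n hψ hφ h0 hδ hη hα]
  rfl

lemma comp_lift_of_ne (m : ℤ) (hφ : ∀ k, 1 ≤ k → IsNice k (φ k)) (ψ : ℕ → AMap V)
    (d : ℕ → ℤ) (h : ℕ → V) (h0 : tokenCount A f (top X) ≠ 0) :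
    comp m (lift φ) (lift ψ) X d h A f = 0 := by
  refine Finset.sum_eq_zero ?_
  rintro ⟨T, B⟩ hP
  obtain ⟨hTX, hBA, hTn, hBT⟩ := mem_feeds.1 hP
  dsimp only at hTX hBA hTn hBT ⊢
  rw [smul_eq_zero_of_right]
  by_cases hB0 : tokenCount B f (top T) = 0
  · rw [insertAt, lift_of_ne]
    have hXn := hTn.mono hTX
    have hC : top (contract X T) = top X := by
      refine top_eq_of ?_ fun y hy => ?_
      · by_cases hXT : top X ∈ T
        · have := le_antisymm (le_top (hTX (top_mem hTn))) (le_top hXT)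
          exact Finset.mem_insert.2 (Or.inl this.symm)
        · exact Finset.mem_insert.2 (Or.inr (Finset.mem_sdiff.2 ⟨top_mem hXn, hXT⟩))
      · rcases Finset.mem_insert.1 hy with rfl | hy
        · exact le_top (hTX (top_mem hTn))
        · exact le_top (Finset.mem_sdiff.1 hy).1
    rw [hC]
    by_cases hXT : top X ∈ T
    · have hTtop := le_antisymm (le_top (hTX (top_mem hTn))) (le_top hXT)
      rw [← hTtop] at h0 ⊢
      rw [tokenCount_pushTokens_top hTn hBA]
      intro hs
      have := Finset.sum_eq_zero_iff.1 hs _ (top_mem hTn)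
      omega
    · rwa [tokenCount_pushTokens_of_notMem hTn hBT hXT]
  · exact insertAt_lift_of_ne m hφ ψ d h hB0

lemma comp_empty (m : ℤ) (Φ Ψ : LMap V) (d : ℕ → ℤ) (h : ℕ → V) (A : Finset (ℕ × ℕ))
    (f : ℕ × ℕ → ℕ) : comp m Φ Ψ ∅ d h A f = 0 := by
  rw [comp_eq_sum_powersetCard]
  simp

lemma lift_Br (n m : ℤ) (hφ : ∀ k, 1 ≤ k → IsNice k (φ k)) (hψ : ∀ k, 1 ≤ k → IsNice k (ψ k)) :
    lift (Br n m φ ψ) = bracket n m (lift φ) (lift ψ) := by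
  funext X d h A f
  by_cases hX : X.Nonempty ∧ tokenCount A f (top X) = 0
  · rw [lift, if_pos hX]
    exact factorial_smul_Br n m hφ hψ rfl hX.2 (fun _ _ => rfl) (fun _ _ => rfl) (fun _ _ => rfl)
  · rw [lift, if_neg hX]
    simp only [bracket, Pi.sub_apply, Pi.smul_apply]
    rcases X.eq_empty_or_nonempty with rfl | hX'
    · rw [comp_empty, comp_empty, smul_zero, sub_zero]
    · have h0 : tokenCount A f (top X) ≠ 0 := fun h0 => hX ⟨hX', h0⟩
      rw [comp_lift_of_ne m hφ ψ d h h0, comp_lift_of_ne n hψ φ d h h0, smul_zero, sub_zero]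

end Bracket

/-- The set of tokens that has `a t` tokens on each label `t < p - 1`. -/
def exponentTokens (p : ℕ) (a : ℕ → ℕ) : Finset (ℕ × ℕ) :=
  (Finset.range (p - 1)).biUnion fun t => (Finset.range (a t)).image (Prod.mk t)

lemma mem_exponentTokens {p : ℕ} {a : ℕ → ℕ} {y : ℕ × ℕ} :
    y ∈ exponentTokens p a ↔ y.1 < p - 1 ∧ y.2 < a y.1 := by
  simp only [exponentTokens, Finset.mem_biUnion, Finset.mem_range, Finset.mem_image]
  constructor
  · rintro ⟨t, ht, j, hj, rfl⟩
    exact ⟨ht, hj⟩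
  · rintro ⟨h1, h2⟩
    exact ⟨y.1, h1, y.2, h2, rfl⟩

lemma tokenCount_exponentTokens {p : ℕ} {a : ℕ → ℕ} {t : ℕ} (ht : t < p - 1) :
    tokenCount (exponentTokens p a) Prod.fst t = a t := by
  have : (exponentTokens p a).filter (Prod.fst · = t) = (Finset.range (a t)).image (Prod.mk t) := by
    ext ⟨x, j⟩
    simp only [Finset.mem_filter, mem_exponentTokens, Finset.mem_image, Finset.mem_range,
      Prod.mk.injEq]
    constructor
    · rintro ⟨⟨_, h2⟩, rfl⟩
      exact ⟨j, h2, rfl, rfl⟩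
    · rintro ⟨j', h2, rfl, rfl⟩
      exact ⟨⟨ht, h2⟩, rfl⟩
  rw [tokenCount, this, Finset.card_image_of_injective _ (Prod.mk_right_injective t),
    Finset.card_range]

lemma range_isEnum (p : ℕ) : IsEnum (Finset.range p) p id :=
  ⟨Finset.card_range p, fun _ hs => Finset.mem_range.2 hs, fun _ _ hst _ => hst⟩

lemma tokenCount_exponentTokens_top {p : ℕ} (hp : 1 ≤ p) (a : ℕ → ℕ) :
    tokenCount (exponentTokens p a) Prod.fst (top (Finset.range p)) = 0 := by
  obtain ⟨q, rfl⟩ : ∃ q, p = q + 1 := ⟨p - 1, by omega⟩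
  rw [(range_isEnum (q + 1)).top_eq, tokenCount, Finset.card_eq_zero, Finset.filter_eq_empty_iff]
  intro y hy
  have := (mem_exponentTokens.1 hy).1
  simp only [id]
  omega

/-- The product of the factorials of the exponents. -/
def factorialProd (p : ℕ) (a : ℕ → ℕ) : ℕ :=
  ∏ x ∈ Finset.range p, (tokenCount (exponentTokens p a) Prod.fst x).factorial

lemma factorialProd_ne_zero (p : ℕ) (a : ℕ → ℕ) : factorialProd p a ≠ 0 :=
  Finset.prod_ne_zero_iff.2 fun _ _ => Nat.factorial_ne_zero _

lemma factorialProd_smul_Br (n m : ℤ) {φ ψ : ℕ → AMap V} (hφ : ∀ k, 1 ≤ k → IsNice k (φ k))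
    (hψ : ∀ k, 1 ≤ k → IsNice k (ψ k)) {p : ℕ} (hp : 1 ≤ p) {d δ : ℕ → ℤ} {h η : ℕ → V}
    {a α : ℕ → ℕ} (hδ : ∀ s < p, δ s = d s) (hη : ∀ s < p, η s = h s)
    (hα : ∀ s < p - 1, α s = a s) :
    factorialProd p a • Br n m φ ψ p δ η α
      = bracket n m (lift φ) (lift ψ) (Finset.range p) d h (exponentTokens p a) Prod.fst := by
  refine factorial_smul_Br n m hφ hψ (Finset.card_range p)
    (tokenCount_exponentTokens_top hp a) (fun s hs => ?_) (fun s hs => ?_) (fun s hs => ?_)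
  · rw [(range_isEnum p).enum_eq hs, hδ s hs, id]
  · rw [(range_isEnum p).enum_eq hs, hη s hs, id]
  · rw [(range_isEnum p).enum_eq (by omega), hα s (by omega), id,
      tokenCount_exponentTokens (by omega)]

lemma bracket_isAdditive (n m : ℤ) {Φ Ψ : LMap V} (lΦ : IsLocal Φ) (hΦ : IsAdditive Φ)
    (lΨ : IsLocal Ψ) (hΨ : IsAdditive Ψ) : IsAdditive (bracket n m Φ Ψ) := by
  intro X d h A f x hx u v
  simp only [bracket, Pi.sub_apply, Pi.smul_apply]
  rw [comp_isAdditive m lΦ hΦ lΨ hΨ X d h A f x hx u v,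
    comp_isAdditive n lΨ hΨ lΦ hΦ X d h A f x hx u v, smul_add]
  abel

lemma nsmul_cancel [Module ℂ V] {N : ℕ} (hN : N ≠ 0) {u v : V} (h : N • u = N • v) : u = v := by
  rw [← Nat.cast_smul_eq_nsmul ℂ, ← Nat.cast_smul_eq_nsmul ℂ] at h
  exact smul_right_injective V (Nat.cast_ne_zero.2 hN) h

lemma Br_isNice [Module ℂ V] (n m : ℤ) {φ ψ : ℕ → AMap V} (hφ : ∀ k, 1 ≤ k → IsNice k (φ k))
    (hψ : ∀ k, 1 ≤ k → IsNice k (ψ k)) (p : ℕ) (hp : 1 ≤ p) : IsNice p (Br n m φ ψ p) := by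
  constructor
  · intro d d' h h' a a' hd hh ha
    refine nsmul_cancel (factorialProd_ne_zero p a') ?_
    rw [factorialProd_smul_Br n m hφ hψ hp hd hh ha, factorialProd_smul_Br n m hφ hψ hp
      (fun _ _ => rfl) (fun _ _ => rfl) (fun _ _ => rfl)]
  · intro d h a j hj u v
    refine nsmul_cancel (factorialProd_ne_zero p a) ?_
    rw [smul_add]
    simp only [factorialProd_smul_Br n m hφ hψ hp (fun _ _ => rfl) (fun _ _ => rfl)
      (fun _ _ => rfl)]
    exact bracket_isAdditive n m (lift_isLocal hφ) (lift_isAdditive hφ) (lift_isLocal hψ)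
      (lift_isAdditive hψ) _ _ _ _ _ _ (Finset.mem_range.2 hj) u v

lemma Br_skew (n m : ℤ) (φ ψ : ℕ → AMap V) (p : ℕ) (d : ℕ → ℤ) (h : ℕ → V) (a : ℕ → ℕ) :
    Br n m φ ψ p d h a = - ((Int.negOnePow (n * m)) : ℤ) • Br m n ψ φ p d h a := by
  have hsq : ((Int.negOnePow (n * m)) : ℤ) * ((Int.negOnePow (n * m)) : ℤ) = 1 := by
    rw [← Units.val_mul, ← Int.negOnePow_add, Int.negOnePow_even _ ⟨_, rfl⟩, Units.val_one]
  simp only [Br, Finset.sum_sub_distrib, ← Finset.smul_sum]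
  rw [sum_Icc_reflect p (fun k l => dia n k l (ψ k) (φ l) d h a),
    sum_Icc_reflect p (fun k l => dia m k l (φ k) (ψ l) d h a), smul_sub, smul_smul, neg_mul,
    hsq, mul_comm m n]
  simp only [neg_smul, one_smul]
  abel

lemma Br_jacobi [Module ℂ V] (n m r : ℤ) {φ ψ χ : ℕ → AMap V}
    (hφ : ∀ k, 1 ≤ k → IsNice k (φ k)) (hψ : ∀ k, 1 ≤ k → IsNice k (ψ k))
    (hχ : ∀ k, 1 ≤ k → IsNice k (χ k)) {p : ℕ} (hp : 1 ≤ p) (d : ℕ → ℤ) (h : ℕ → V)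
    (a : ℕ → ℕ) :
    Br n (m + r) φ (Br m r ψ χ) p d h a
      = Br (n + m) r (Br n m φ ψ) χ p d h a
        + ((Int.negOnePow (n * m)) : ℤ) • Br m (n + r) ψ (Br n r φ χ) p d h a := by
  refine nsmul_cancel (factorialProd_ne_zero p a) ?_
  rw [smul_add, smul_comm,
    factorialProd_smul_Br n (m + r) hφ (Br_isNice m r hψ hχ) hp (fun _ _ => rfl)
      (fun _ _ => rfl) (fun _ _ => rfl),
    factorialProd_smul_Br (n + m) r (Br_isNice n m hφ hψ) hχ hp (fun _ _ => rfl)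
      (fun _ _ => rfl) (fun _ _ => rfl),
    factorialProd_smul_Br m (n + r) hψ (Br_isNice n r hφ hχ) hp (fun _ _ => rfl)
      (fun _ _ => rfl) (fun _ _ => rfl),
    lift_Br m r hψ hχ, lift_Br n m hφ hψ, lift_Br n r hφ hχ]
  exact bracket_jacobi n m r (lift_isLocal hφ) (lift_isAdditive hφ) (lift_isLocal hψ)
    (lift_isAdditive hψ) (lift_isLocal hχ) (lift_isAdditive hχ) _ _ _ _ _

lemma isNice_of_isArity [Module ℂ V] {k : ℕ} {φ : AMap V} (h1 : IsArity k φ)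
    (h2 : IsMultilin k φ) : IsNice k φ :=
  ⟨fun _ hh ha => h1 _ _ _ _ _ _ hh ha, fun d h a j hj u v => (h2 d h a j hj).1 u v⟩

end LCG

namespace LCG
/-- `(C•_cs(ℋ), ⟦·,·⟧)` is a graded Lie algebra: the bracket
`⟦φ,ψ⟧ = Σ_{k+l=p+1}(φ_k ⋄ ψ_l − (−1)^{mn} ψ_l ⋄ φ_k)` is graded skew-symmetric and
satisfies the graded Jacobi identity (evaluated on homogeneous arguments). -/
theorem stmt4 (V : Type) [AddCommGroup V] [Module ℂ V]
    (G : ℤ → Submodule ℂ V) (hInt : DirectSum.IsInternal G)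
    (D : V →ₗ[ℂ] V) (hD : ∀ (i : ℤ) (x : V), x ∈ G i → D x ∈ G i)
    (n m r : ℤ) (φ ψ χ : ℕ → AMap V)
    (hφ : ∀ k, 1 ≤ k → IsArity k (φ k) ∧ IsMultilin k (φ k) ∧ IsSesq D k (φ k)
      ∧ HasDeg G k n (φ k))
    (hψ : ∀ k, 1 ≤ k → IsArity k (ψ k) ∧ IsMultilin k (ψ k) ∧ IsSesq D k (ψ k)
      ∧ HasDeg G k m (ψ k))
    (hχ : ∀ k, 1 ≤ k → IsArity k (χ k) ∧ IsMultilin k (χ k) ∧ IsSesq D k (χ k)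
      ∧ HasDeg G k r (χ k))
    (hφfin : ∃ K, ∀ k, K ≤ k → φ k = fun _ _ _ => 0)
    (hψfin : ∃ K, ∀ k, K ≤ k → ψ k = fun _ _ _ => 0)
    (hχfin : ∃ K, ∀ k, K ≤ k → χ k = fun _ _ _ => 0) :
    -- graded skew-symmetry
    (∀ (d : ℕ → ℤ) (h : ℕ → V), (∀ t, h t ∈ G (d t)) → ∀ p, 1 ≤ p → ∀ a,
      Br n m φ ψ p d h a = - ((Int.negOnePow (n * m)) : ℤ) • Br m n ψ φ p d h a) ∧
    -- graded Jacobi identity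
    (∀ (d : ℕ → ℤ) (h : ℕ → V), (∀ t, h t ∈ G (d t)) → ∀ p, 1 ≤ p → ∀ a,
      Br n (m + r) φ (Br m r ψ χ) p d h a
        = Br (n + m) r (Br n m φ ψ) χ p d h a
          + ((Int.negOnePow (n * m)) : ℤ) • Br m (n + r) ψ (Br n r φ χ) p d h a) := by
  have niceφ k (hk : 1 ≤ k) := isNice_of_isArity (hφ k hk).1 (hφ k hk).2.1
  have niceψ k (hk : 1 ≤ k) := isNice_of_isArity (hψ k hk).1 (hψ k hk).2.1
  have niceχ k (hk : 1 ≤ k) := isNice_of_isArity (hχ k hk).1 (hχ k hk).2.1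
  exact ⟨fun d h _ p _ a => Br_skew n m φ ψ p d h a,
    fun d h _ p hp a => Br_jacobi n m r niceφ niceψ niceχ hp d h a⟩
end LCG
end
end

section
/- Let (𝒢₁ →d 𝒢₀, ρ₂, ρ₃ = 0) be a strict 2-term Leib∞-conformal algebra. Then (𝒢₁, 𝒢₀, d, Φˡ := ρ₂|_{𝒢₀⊗𝒢₁}, Φʳ := ρ₂|_{𝒢₁⊗𝒢₀}) is a crossed module of Leibniz conformal algebras, where 𝒢₀ carries the λ-bracket [x_λ y]⁰ := (ρ₂)_λ(x,y) and 𝒢₁ carries the λ-bracket [u_λ v]¹ := (ρ₂)_λ(du, v). (Here the roles are: 𝔤 = 𝒢₁, 𝔥 = 𝒢₀, Φˡ : 𝔥⊗𝔤 → 𝔤[[λ]] is Φˡ_λ(x,v) = (ρ₂)_λ(x,v) and Φʳ : 𝔤⊗𝔥 → 𝔤[[λ]] is Φʳ_λ(v,x) = (ρ₂)_λ(v,x).) -/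
noncomputable section

open scoped BigOperators

namespace LCF

variable {M : Type*}

/-- Multiplication by the formal variable `λ` on `M[[λ]]`, where an element of `M[[λ]]`
is encoded by its sequence of coefficients `ℕ → M`. -/
def lmul [AddCommGroup M] (f : ℕ → M) : ℕ → M
  | 0 => 0
  | n + 1 => f n

/-- Multiplication by `λ` (the first variable) on `M[[λ,μ]]`. -/
def lmul1 [AddCommGroup M] (f : ℕ → ℕ → M) : ℕ → ℕ → M
  | 0 => fun _ => 0
  | m + 1 => f m

/-- Multiplication by `μ` (the second variable) on `M[[λ,μ]]`. -/
def lmul2 [AddCommGroup M] (f : ℕ → ℕ → M) : ℕ → ℕ → M :=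
  fun m => lmul (f m)

/-- The coefficient of `λ^m μ^n` in `F(λ+μ)` where `F j r` is the coefficient of
`λ^j ν^r` in a two-variable expression `F(λ, ν)` which is evaluated at `ν = λ + μ`.
This encodes expressions such as `[[x_λ y]_{λ+μ} z]`. -/
def substSum [AddCommMonoid M] (F : ℕ → ℕ → M) (m n : ℕ) : M :=
  ∑ j ∈ Finset.range (m + 1), ((m - j + n).choose n) • F j (m - j + n)

/-- Three-variable analogue of `substSum`, encoding expressions such as
`[(ρ₃)_{λ,μ}(x,y,z)_{λ+μ+ν} w]`:  coefficient of `λ^a μ^b ν^c`. -/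
def substSum3 [AddCommMonoid M] (F : ℕ → ℕ → ℕ → M) (a b c : ℕ) : M :=
  ∑ j ∈ Finset.range (a + 1), ∑ k ∈ Finset.range (b + 1),
    ((((a - j) + (b - k)).choose (b - k)) * (((a - j) + (b - k) + c).choose c)) •
      F j k ((a - j) + (b - k) + c)

/-- A Leibniz conformal algebra: a `ℂ[∂]`-module `g` (given by a ℂ-module with the
action of `∂` recorded by the linear map `D`) together with a ℂ-bilinear
`λ`-bracket `br : g ⊗ g → g[[λ]]` (given by its coefficients) which is conformal
sesquilinear and satisfies the Leibniz conformal identity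
`[x_λ [y_μ z]] = [[x_λ y]_{λ+μ} z] + [y_μ [x_λ z]]` (written coefficientwise). -/
structure LeibConfAlg (g : Type*) [AddCommGroup g] [Module ℂ g] where
  D : g →ₗ[ℂ] g
  br : g →ₗ[ℂ] g →ₗ[ℂ] (ℕ → g)
  sesqL : ∀ x y, br (D x) y = - lmul (br x y)
  sesqR : ∀ x y, br x (D y) = (fun n => D (br x y n)) + lmul (br x y)
  leib : ∀ x y z m n,
    br x (br y z n) m = substSum (fun j s => br (br x y j) z s) m n + br y (br x z m) n

/-- A representation of a Leibniz conformal algebra: a `ℂ[∂]`-module `M` with left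
and right `λ`-actions satisfying the usual compatibility axioms. -/
structure LeibConfRep (g W : Type*) [AddCommGroup g] [Module ℂ g]
    [AddCommGroup W] [Module ℂ W] (A : LeibConfAlg g) where
  DM : W →ₗ[ℂ] W
  lact : g →ₗ[ℂ] W →ₗ[ℂ] (ℕ → W)
  ract : W →ₗ[ℂ] g →ₗ[ℂ] (ℕ → W)
  sesqLl : ∀ x v, lact (A.D x) v = - lmul (lact x v)
  sesqLr : ∀ x v, lact x (DM v) = (fun n => DM (lact x v n)) + lmul (lact x v)
  sesqRl : ∀ v x, ract (DM v) x = - lmul (ract v x)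
  sesqRr : ∀ v x, ract v (A.D x) = (fun n => DM (ract v x n)) + lmul (ract v x)
  rep1 : ∀ x y v m n,
    lact x (lact y v n) m = substSum (fun j s => lact (A.br x y j) v s) m n + lact y (lact x v m) n
  rep2 : ∀ x v y m n,
    lact x (ract v y n) m = substSum (fun j s => ract (lact x v j) y s) m n + ract v (A.br x y m) n
  rep3 : ∀ v x y m n,
    ract v (A.br x y n) m = substSum (fun j s => ract (ract v x j) y s) m n + lact x (ract v y m) n

/-- A `2`-term `Leib_∞`-conformal algebra `(𝒢₁ →d 𝒢₀, ρ₂, ρ₃)` (Definition 4.1 of the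
paper), written in terms of the coefficients of all `λ`-brackets.  The components of
`ρ₂` are `ρ00 : 𝒢₀ ⊗ 𝒢₀ → 𝒢₀[[λ]]`, `ρ01 : 𝒢₀ ⊗ 𝒢₁ → 𝒢₁[[λ]]`, `ρ10 : 𝒢₁ ⊗ 𝒢₀ → 𝒢₁[[λ]]`
(condition (i) of the definition says that the component of `ρ₂` on `𝒢₁ ⊗ 𝒢₁`
vanishes, so it is not recorded). -/
structure TwoTerm (G0 G1 : Type*) [AddCommGroup G0] [Module ℂ G0]
    [AddCommGroup G1] [Module ℂ G1] where
  D0 : G0 →ₗ[ℂ] G0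
  D1 : G1 →ₗ[ℂ] G1
  d : G1 →ₗ[ℂ] G0
  hdD : ∀ v, d (D1 v) = D0 (d v)
  ρ00 : G0 →ₗ[ℂ] G0 →ₗ[ℂ] (ℕ → G0)
  ρ01 : G0 →ₗ[ℂ] G1 →ₗ[ℂ] (ℕ → G1)
  ρ10 : G1 →ₗ[ℂ] G0 →ₗ[ℂ] (ℕ → G1)
  ρ3 : G0 →ₗ[ℂ] G0 →ₗ[ℂ] G0 →ₗ[ℂ] (ℕ → ℕ → G1)
  sesq00l : ∀ x y, ρ00 (D0 x) y = - lmul (ρ00 x y)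
  sesq00r : ∀ x y, ρ00 x (D0 y) = (fun n => D0 (ρ00 x y n)) + lmul (ρ00 x y)
  sesq01l : ∀ x u, ρ01 (D0 x) u = - lmul (ρ01 x u)
  sesq01r : ∀ x u, ρ01 x (D1 u) = (fun n => D1 (ρ01 x u n)) + lmul (ρ01 x u)
  sesq10l : ∀ u x, ρ10 (D1 u) x = - lmul (ρ10 u x)
  sesq10r : ∀ u x, ρ10 u (D0 x) = (fun n => D1 (ρ10 u x n)) + lmul (ρ10 u x)
  sesq3a : ∀ x y z, ρ3 (D0 x) y z = - lmul1 (ρ3 x y z)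
  sesq3b : ∀ x y z, ρ3 x (D0 y) z = - lmul2 (ρ3 x y z)
  sesq3c : ∀ x y z, ρ3 x y (D0 z)
    = (fun m n => D1 (ρ3 x y z m n)) + lmul1 (ρ3 x y z) + lmul2 (ρ3 x y z)
  /-- condition (ii) -/
  c2 : ∀ x u n, d (ρ01 x u n) = ρ00 x (d u) n
  /-- condition (iii) -/
  c3 : ∀ u x n, d (ρ10 u x n) = ρ00 (d u) x n
  /-- condition (iv) -/
  c4 : ∀ u v, ρ01 (d u) v = ρ10 u (d v)
  /-- condition (v) -/
  c5 : ∀ x y z m n, d (ρ3 x y z m n)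
    = ρ00 x (ρ00 y z n) m - substSum (fun j s => ρ00 (ρ00 x y j) z s) m n - ρ00 y (ρ00 x z m) n
  /-- condition (vi) -/
  c6 : ∀ x y v m n, ρ3 x y (d v) m n
    = ρ01 x (ρ01 y v n) m - substSum (fun j s => ρ01 (ρ00 x y j) v s) m n - ρ01 y (ρ01 x v m) n
  /-- condition (vii) -/
  c7 : ∀ x v y m n, ρ3 x (d v) y m n
    = ρ01 x (ρ10 v y n) m - substSum (fun j s => ρ10 (ρ01 x v j) y s) m n - ρ10 v (ρ00 x y m) n
  /-- condition (viii) -/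
  c8 : ∀ v x y m n, ρ3 (d v) x y m n
    = ρ10 v (ρ00 x y n) m - substSum (fun j s => ρ10 (ρ10 v x j) y s) m n - ρ01 x (ρ10 v y m) n
  /-- condition (ix): the conformal Leibnizator identity -/
  c9 : ∀ x y z w a b c,
    ρ01 x (ρ3 y z w b c) a - ρ01 y (ρ3 x z w a c) b + ρ01 z (ρ3 x y w a b) c
      + substSum3 (fun j k r => ρ10 (ρ3 x y z j k) w r) a b c
      - substSum (fun j r => ρ3 (ρ00 x y j) z w r c) a b
      - substSum (fun j r => ρ3 y (ρ00 x z j) w b r) a c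
      - ρ3 y z (ρ00 x w a) b c
      + substSum (fun j r => ρ3 x (ρ00 y z j) w a r) b c
      + ρ3 x z (ρ00 y w b) a c
      - ρ3 x y (ρ00 z w c) a b = 0

end LCF

namespace LCF
/-- A crossed module of Leibniz conformal algebras `(𝔤, 𝔥, d, Φˡ, Φʳ)`. -/
structure CrossedMod (gg hh : Type*) [AddCommGroup gg] [Module ℂ gg]
    [AddCommGroup hh] [Module ℂ hh] where
  Ag : LeibConfAlg gg
  Ah : LeibConfAlg hh
  d : gg →ₗ[ℂ] hh
  dD : ∀ x, d (Ag.D x) = Ah.D (d x)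
  dbr : ∀ x y n, d (Ag.br x y n) = Ah.br (d x) (d y) n
  Φl : hh →ₗ[ℂ] gg →ₗ[ℂ] (ℕ → gg)
  Φr : gg →ₗ[ℂ] hh →ₗ[ℂ] (ℕ → gg)
  sesqLl : ∀ h x, Φl (Ah.D h) x = - lmul (Φl h x)
  sesqLr : ∀ h x, Φl h (Ag.D x) = (fun n => Ag.D (Φl h x n)) + lmul (Φl h x)
  sesqRl : ∀ x h, Φr (Ag.D x) h = - lmul (Φr x h)
  sesqRr : ∀ x h, Φr x (Ah.D h) = (fun n => Ag.D (Φr x h n)) + lmul (Φr x h)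
  -- 𝔤 is a representation of 𝔥 via `Φˡ` (left action) and `Φʳ` (right action)
  rep1 : ∀ h k x m n,
    Φl h (Φl k x n) m = substSum (fun j s => Φl (Ah.br h k j) x s) m n + Φl k (Φl h x m) n
  rep2 : ∀ h x k m n,
    Φl h (Φr x k n) m = substSum (fun j s => Φr (Φl h x j) k s) m n + Φr x (Ah.br h k m) n
  rep3 : ∀ x h k m n,
    Φr x (Ah.br h k n) m = substSum (fun j s => Φr (Φr x h j) k s) m n + Φl h (Φr x k m) n
  cm1 : ∀ h x n, d (Φl h x n) = Ah.br h (d x) n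
  cm2 : ∀ x h n, d (Φr x h n) = Ah.br (d x) h n
  cm3l : ∀ x y, Φl (d x) y = Ag.br x y
  cm3r : ∀ x y, Φr x (d y) = Ag.br x y
  cm4 : ∀ x y h m n,
    Ag.br x (Φr y h n) m = substSum (fun j s => Φr (Ag.br x y j) h s) m n + Ag.br y (Φr x h m) n
  cm5 : ∀ x h y m n,
    Ag.br x (Φl h y n) m = substSum (fun j s => Ag.br (Φr x h j) y s) m n + Φl h (Ag.br x y m) n
  cm6 : ∀ h x y m n,
    Φl h (Ag.br x y n) m = substSum (fun j s => Ag.br (Φl h x j) y s) m n + Ag.br x (Φl h y m) n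
end LCF

namespace LCF
/-- In a strict algebra the left action of `𝒢₀` on `𝒢₁` is compatible with the bracket. -/
theorem TwoTerm.rep_left {G0 G1 : Type*} [AddCommGroup G0] [Module ℂ G0]
    [AddCommGroup G1] [Module ℂ G1] (T : TwoTerm G0 G1) (hstrict : T.ρ3 = 0)
    (x y : G0) (v : G1) (m n : ℕ) :
    T.ρ01 x (T.ρ01 y v n) m
      = substSum (fun j s => T.ρ01 (T.ρ00 x y j) v s) m n + T.ρ01 y (T.ρ01 x v m) n := by
  have h := T.c6 x y v m n
  simp only [hstrict, LinearMap.zero_apply, Pi.zero_apply] at h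
  rwa [sub_sub, eq_comm, sub_eq_zero] at h

/-- In a strict algebra the left and right actions of `𝒢₀` on `𝒢₁` are compatible. -/
theorem TwoTerm.rep_left_right {G0 G1 : Type*} [AddCommGroup G0] [Module ℂ G0]
    [AddCommGroup G1] [Module ℂ G1] (T : TwoTerm G0 G1) (hstrict : T.ρ3 = 0)
    (x : G0) (v : G1) (y : G0) (m n : ℕ) :
    T.ρ01 x (T.ρ10 v y n) m
      = substSum (fun j s => T.ρ10 (T.ρ01 x v j) y s) m n + T.ρ10 v (T.ρ00 x y m) n := by
  have h := T.c7 x v y m n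
  simp only [hstrict, LinearMap.zero_apply, Pi.zero_apply] at h
  rwa [sub_sub, eq_comm, sub_eq_zero] at h

/-- In a strict algebra the right action of `𝒢₀` on `𝒢₁` is compatible with the bracket. -/
theorem TwoTerm.rep_right {G0 G1 : Type*} [AddCommGroup G0] [Module ℂ G0]
    [AddCommGroup G1] [Module ℂ G1] (T : TwoTerm G0 G1) (hstrict : T.ρ3 = 0)
    (v : G1) (x y : G0) (m n : ℕ) :
    T.ρ10 v (T.ρ00 x y n) m
      = substSum (fun j s => T.ρ10 (T.ρ10 v x j) y s) m n + T.ρ01 x (T.ρ10 v y m) n := by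
  have h := T.c8 v x y m n
  simp only [hstrict, LinearMap.zero_apply, Pi.zero_apply] at h
  rwa [sub_sub, eq_comm, sub_eq_zero] at h

/-- The degree-zero part of a strict algebra, as a Leibniz conformal algebra. -/
def TwoTerm.algZero {G0 G1 : Type*} [AddCommGroup G0] [Module ℂ G0]
    [AddCommGroup G1] [Module ℂ G1] (T : TwoTerm G0 G1) (hstrict : T.ρ3 = 0) :
    LeibConfAlg G0 where
  D := T.D0
  br := T.ρ00
  sesqL := T.sesq00l
  sesqR := T.sesq00r
  leib x y z m n := by
    have h := T.c5 x y z m n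
    simp only [hstrict, LinearMap.zero_apply, Pi.zero_apply, map_zero] at h
    rwa [sub_sub, eq_comm, sub_eq_zero] at h

/-- The degree-one part of a strict algebra, with the bracket `[u_λ v] = (ρ₂)_λ(du, v)`. -/
def TwoTerm.algOne {G0 G1 : Type*} [AddCommGroup G0] [Module ℂ G0]
    [AddCommGroup G1] [Module ℂ G1] (T : TwoTerm G0 G1) (hstrict : T.ρ3 = 0) :
    LeibConfAlg G1 where
  D := T.D1
  br := T.ρ01 ∘ₗ T.d
  sesqL x y := by simp only [LinearMap.comp_apply, T.hdD, T.sesq01l]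
  sesqR x y := T.sesq01r (T.d x) y
  leib x y z m n := by
    simp only [LinearMap.comp_apply, T.c2]
    exact T.rep_left hstrict _ _ _ _ _

/-- The crossed module of Leibniz conformal algebras defined by a strict algebra. -/
def TwoTerm.crossedMod {G0 G1 : Type*} [AddCommGroup G0] [Module ℂ G0]
    [AddCommGroup G1] [Module ℂ G1] (T : TwoTerm G0 G1) (hstrict : T.ρ3 = 0) :
    CrossedMod G1 G0 where
  Ag := T.algOne hstrict
  Ah := T.algZero hstrict
  d := T.d
  dD := T.hdD
  dbr x y n := T.c2 (T.d x) y n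
  Φl := T.ρ01
  Φr := T.ρ10
  sesqLl := T.sesq01l
  sesqLr := T.sesq01r
  sesqRl := T.sesq10l
  sesqRr := T.sesq10r
  rep1 := T.rep_left hstrict
  rep2 := T.rep_left_right hstrict
  rep3 := T.rep_right hstrict
  cm1 := T.c2
  cm2 := T.c3
  cm3l _ _ := rfl
  cm3r x y := (T.c4 x y).symm
  cm4 x y h m n := by
    simp only [TwoTerm.algOne, LinearMap.comp_apply]
    rw [T.rep_left_right hstrict, T.c4 y, T.c3]
  cm5 x h y m n := by
    simp only [TwoTerm.algOne, LinearMap.comp_apply, T.c3]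
    exact T.rep_left hstrict _ _ _ _ _
  cm6 h x y m n := by
    simp only [TwoTerm.algOne, LinearMap.comp_apply, T.c2]
    exact T.rep_left hstrict _ _ _ _ _

/-- Every strict `2`-term `Leib_∞`-conformal algebra gives rise to a crossed module of
Leibniz conformal algebras `(𝔤 = 𝒢₁, 𝔥 = 𝒢₀, d, Φˡ = ρ₂|_{𝒢₀⊗𝒢₁}, Φʳ = ρ₂|_{𝒢₁⊗𝒢₀})`. -/
theorem stmt16 {G0 G1 : Type*} [AddCommGroup G0] [Module ℂ G0]
    [AddCommGroup G1] [Module ℂ G1] (T : TwoTerm G0 G1) (hstrict : T.ρ3 = 0) :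
    ∃ C : CrossedMod G1 G0,
      C.d = T.d ∧ C.Ah.D = T.D0 ∧ C.Ah.br = T.ρ00 ∧ C.Ag.D = T.D1 ∧
      (∀ u v, C.Ag.br u v = T.ρ01 (T.d u) v) ∧
      (∀ x u, C.Φl x u = T.ρ01 x u) ∧
      (∀ u x, C.Φr u x = T.ρ10 u x) := by
  exact ⟨T.crossedMod hstrict, rfl, rfl, rfl, rfl, fun _ _ => rfl, fun _ _ => rfl, fun _ _ => rfl⟩
end LCF
end
end
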